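/- arXiv:2110.11224 — 2 statements merged into one kernel-verified Lean document; each statement's English description precedes it below -/
import Mathlib

section
/- Let k ≥ 2 be an integer and let p ∈ [2,4]. Then for every ε > 0 there exists a constant C_ε > 0, depending only on k, p and ε, such that for every positive integer N and every sequence of complex numbers (a_n)_{n=-N}^{N}, one has ‖∑_{n=-N}^{N} a_n e(n x − n² x^k)‖_{L^p(-1,1)} ≤ C_ε N^{(2k−1)/(6(k−1)) − (k+1)/(3p(k−1)) + ε} (∑_{n=-N}^{N} |a_n|²)^{1/2}. -/
open MeasureTheory

/-- `e z = e^{2πiz}`. -/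
noncomputable def e (t : ℝ) : ℂ := Complex.exp (2 * Real.pi * Complex.I * t)

lemma norm_e (t : ℝ) : ‖e t‖ = 1 := by
  have h : 2 * Real.pi * Complex.I * (t : ℂ) = ((2 * Real.pi * t : ℝ) : ℂ) * Complex.I := by
    push_cast; ring
  rw [e, h, Complex.norm_exp_ofReal_mul_I]

lemma conj_e (t : ℝ) : (starRingEnd ℂ) (e t) = e (-t) := by
  rw [e, e, ← Complex.exp_conj]
  congr 1
  simp [Complex.conj_ofNat]

lemma e_add (s t : ℝ) : e (s + t) = e s * e t := by
  rw [e, e, e, ← Complex.exp_add]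
  congr 1
  push_cast; ring

lemma continuous_e : Continuous e := by
  unfold e; fun_prop

lemma hasDerivAt_e_comp {ψ : ℝ → ℝ} {c x : ℝ} (h : HasDerivAt ψ c x) :
    HasDerivAt (fun y => e (ψ y)) (2 * Real.pi * Complex.I * c * e (ψ x)) x := by
  have h1 : HasDerivAt (fun y => ((ψ y : ℝ) : ℂ)) (c : ℂ) x := h.ofReal_comp
  have h2 := (h1.const_mul (2 * Real.pi * Complex.I)).cexp
  simp only [e]
  convert h2 using 1
  ring

/-- First derivative test for oscillatory integrals with monotone phase derivative. -/
lemma norm_integral_e_le {ψ g g' : ℝ → ℝ} {u v l : ℝ} (huv : u ≤ v) (hl : 0 < l)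
    (hψ : ∀ x, HasDerivAt ψ (g x) x) (hg : ∀ x, HasDerivAt g (g' x) x) (hg' : Continuous g')
    (hs : (∀ x ∈ Set.Icc u v, 0 ≤ g' x) ∨ (∀ x ∈ Set.Icc u v, g' x ≤ 0))
    (hb : ∀ x ∈ Set.Icc u v, l ≤ |g x|) :
    ‖∫ x in u..v, e (ψ x)‖ ≤ 1 / l := by
  have hψc : Continuous ψ := continuous_iff_continuousAt.2 fun x => (hψ x).continuousAt
  have hgc : Continuous g := continuous_iff_continuousAt.2 fun x => (hg x).continuousAt
  have hne : ∀ x ∈ Set.Icc u v, g x ≠ 0 := fun x hx h0 => by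
    have := hb x hx; rw [h0, abs_zero] at this; linarith
  have hI : Set.uIcc u v = Set.Icc u v := Set.uIcc_of_le huv
  have hpi : (2 * Real.pi * Complex.I : ℂ) ≠ 0 := by simp [Real.pi_ne_zero]
  set G : ℝ → ℂ := fun x => e (ψ x) * ((g' x / (g x) ^ 2 : ℝ) : ℂ) / (2 * Real.pi * Complex.I)
  have hGc : ContinuousOn G (Set.uIcc u v) := by
    rw [hI]
    have h1 : ContinuousOn (fun x => ((g' x / (g x) ^ 2 : ℝ) : ℂ)) (Set.Icc u v) :=
      Complex.continuous_ofReal.comp_continuousOn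
        (hg'.continuousOn.div (hgc.pow 2).continuousOn fun x hx => pow_ne_zero _ (hne x hx))
    exact ((continuous_e.comp hψc).continuousOn.mul h1).div_const _
  have hqc : ContinuousOn (fun x => g' x / (g x) ^ 2) (Set.uIcc u v) := by
    rw [hI]
    exact hg'.continuousOn.div (hgc.pow 2).continuousOn fun x hx => pow_ne_zero _ (hne x hx)
  have hder : ∀ x ∈ Set.uIcc u v,
      HasDerivAt (fun y => e (ψ y) * (((g y)⁻¹ : ℝ) : ℂ) / (2 * Real.pi * Complex.I))
        (e (ψ x) - G x) x := by
    intro x hx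
    rw [hI] at hx
    have h1 := (((hasDerivAt_e_comp (hψ x)).mul ((hg x).inv (hne x hx)).ofReal_comp)).div_const
      (2 * Real.pi * Complex.I)
    have h0 : ((g x : ℝ) : ℂ) ≠ 0 := by exact_mod_cast hne x hx
    refine h1.congr_deriv ?_
    simp only [G, Pi.inv_apply]
    push_cast
    field_simp
    ring
  have heI : IntervalIntegrable (fun x => e (ψ x)) volume u v :=
    (continuous_e.comp hψc).intervalIntegrable _ _
  have hmain := intervalIntegral.integral_eq_sub_of_hasDerivAt hder
    (heI.sub hGc.intervalIntegrable)
  rw [intervalIntegral.integral_sub heI hGc.intervalIntegrable] at hmain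
  have hq : ∫ x in u..v, g' x / (g x) ^ 2 = (g u)⁻¹ - (g v)⁻¹ := by
    have := intervalIntegral.integral_eq_sub_of_hasDerivAt
      (f := fun y => -(g y)⁻¹) (f' := fun x => g' x / (g x) ^ 2) (a := u) (b := v)
      (fun x hx => by
        rw [hI] at hx
        exact ((hg x).inv (hne x hx)).neg.congr_deriv (by ring)) hqc.intervalIntegrable
    rw [this]; ring
  have hinv : ∀ x ∈ Set.Icc u v, |(g x)⁻¹| ≤ 1 / l := fun x hx => by
    rw [abs_inv, ← one_div]
    exact one_div_le_one_div_of_le hl (hb x hx)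
  have hu := hinv u ⟨le_rfl, huv⟩
  have hv := hinv v ⟨huv, le_rfl⟩
  have hn2 : ‖(2 * Real.pi * Complex.I : ℂ)‖ = 2 * Real.pi := by
    simp [abs_of_pos Real.pi_pos]
  have hGn : ‖∫ x in u..v, G x‖ ≤ (2 / l) / (2 * Real.pi) := by
    have h1 : ‖∫ x in u..v, G x‖ ≤ ∫ x in u..v, |g' x / (g x) ^ 2| / (2 * Real.pi) := by
      refine intervalIntegral.norm_integral_le_of_norm_le huv ?_ ?_
      · refine Filter.Eventually.of_forall fun x _ => ?_
        simp only [G]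
        rw [norm_div, norm_mul, norm_e, hn2, one_mul, Complex.norm_real, Real.norm_eq_abs]
      · exact (hqc.abs.intervalIntegrable).div_const _
    refine h1.trans ?_
    rw [intervalIntegral.integral_div]
    gcongr
    rw [abs_le] at hu hv
    have h2l : 2 / l = 1 / l + 1 / l := by ring
    rcases hs with hs | hs
    · have : ∫ x in u..v, |g' x / (g x) ^ 2| = ∫ x in u..v, g' x / (g x) ^ 2 :=
        intervalIntegral.integral_congr fun x hx => by
          rw [hI] at hx
          exact abs_of_nonneg (div_nonneg (hs x hx) (sq_nonneg _))
      rw [this, hq]; linarith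
    · have : ∫ x in u..v, |g' x / (g x) ^ 2| = ∫ x in u..v, -(g' x / (g x) ^ 2) :=
        intervalIntegral.integral_congr fun x hx => by
          rw [hI] at hx
          exact abs_of_nonpos (div_nonpos_of_nonpos_of_nonneg (hs x hx) (sq_nonneg _))
      rw [this, intervalIntegral.integral_neg, hq]; linarith
  have hF : ∀ x ∈ Set.Icc u v,
      ‖e (ψ x) * (((g x)⁻¹ : ℝ) : ℂ) / (2 * Real.pi * Complex.I)‖ ≤ (1 / l) / (2 * Real.pi) := by
    intro x hx
    rw [norm_div, norm_mul, norm_e, hn2, one_mul, Complex.norm_real, Real.norm_eq_abs]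
    have := hinv x hx
    have hpi := Real.pi_pos
    gcongr
  have hFu := hF u ⟨le_rfl, huv⟩
  have hFv := hF v ⟨huv, le_rfl⟩
  rw [sub_eq_iff_eq_add] at hmain
  rw [hmain]
  refine (norm_add_le _ _).trans ((add_le_add ((norm_sub_le _ _).trans
    (add_le_add hFv hFu)) hGn).trans ?_)
  have h3 := Real.pi_gt_three
  have : (1 / l) / (2 * Real.pi) + (1 / l) / (2 * Real.pi) + (2 / l) / (2 * Real.pi)
      = (2 / Real.pi) * (1 / l) := by field_simp; ring
  rw [this]
  have h4 : 2 / Real.pi ≤ 1 := by rw [div_le_one Real.pi_pos]; linarith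
  have h5 : 0 ≤ 1 / l := by positivity
  nlinarith

lemma norm_integral_e_monomial_le {k : ℕ} (hk : 2 ≤ k) {h s u v σ : ℝ} (hh : h ≠ 0) (hu : 0 ≤ u)
    (huv : u ≤ v) (hσ : 0 < σ) (hb : ∀ x ∈ Set.Ioo u v, σ ≤ |1 - k * s * x ^ (k - 1)|) :
    ‖∫ x in u..v, e (h * (x - s * x ^ k))‖ ≤ 1 / (|h| * σ) := by
  have hh' : 0 < |h| := abs_pos.2 hh
  rcases huv.eq_or_lt with rfl | huv'
  · simp; positivity
  have hb' : ∀ x ∈ Set.Icc u v, σ ≤ |1 - k * s * x ^ (k - 1)| := by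
    have hcl : IsClosed {x : ℝ | σ ≤ |1 - k * s * x ^ (k - 1)|} :=
      isClosed_le continuous_const (by fun_prop)
    have := closure_minimal (fun x hx => hb x hx) hcl
    rwa [closure_Ioo huv'.ne] at this
  refine norm_integral_e_le (g := fun x => h * (1 - k * s * x ^ (k - 1)))
    (g' := fun x => -(h * s) * (k * ((k - 1 : ℕ) * x ^ (k - 1 - 1)))) huv (by positivity)
    (fun x => ?_) (fun x => ?_) (by fun_prop) ?_ ?_
  · have := ((hasDerivAt_id x).sub ((hasDerivAt_pow k x).const_mul s)).const_mul h
    refine this.congr_deriv ?_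
    ring
  · have := (((hasDerivAt_pow (k - 1) x).const_mul (k * s)).const_sub 1).const_mul h
    refine this.congr_deriv ?_
    ring
  · rcases le_total (h * s) 0 with h0 | h0
    · left
      intro x hx
      have : 0 ≤ x := hu.trans hx.1
      exact mul_nonneg (by linarith) (by positivity)
    · right
      intro x hx
      have : 0 ≤ x := hu.trans hx.1
      exact mul_nonpos_of_nonpos_of_nonneg (by linarith) (by positivity)
  · intro x hx
    rw [abs_mul]
    exact mul_le_mul_of_nonneg_left (hb' x hx) hh'.le

/-- The exponential sum over a finite set of frequencies. -/
noncomputable def expSum (k : ℕ) (a : ℤ → ℂ) (A : Finset ℤ) (x : ℝ) : ℂ :=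
  ∑ n ∈ A, a n * e ((n : ℝ) * x - (n : ℝ) ^ 2 * x ^ k)

lemma continuous_expSum (k : ℕ) (a : ℤ → ℂ) (A : Finset ℤ) : Continuous (expSum k a A) := by
  unfold expSum
  refine continuous_finsetSum _ fun n _ => continuous_const.mul (continuous_e.comp ?_)
  fun_prop

lemma sum_inv_max_one_abs_le (M : ℕ) :
    ∑ h ∈ Finset.Icc (-(M : ℤ)) M, (max 1 |(h : ℝ)|)⁻¹ ≤ 1 + 2 * (harmonic M : ℝ) := by
  induction M with
  | zero => simp
  | succ M ih =>
    have h1 : Finset.Icc (-((M + 1 : ℕ) : ℤ)) ((M + 1 : ℕ) : ℤ)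
        = insert (-((M : ℤ) + 1)) (insert ((M : ℤ) + 1) (Finset.Icc (-(M : ℤ)) M)) := by
      ext h; simp; omega
    rw [h1, Finset.sum_insert (by simp; omega), Finset.sum_insert (by simp), harmonic_succ]
    have h2 : (max 1 |(((-((M : ℤ) + 1) : ℤ)) : ℝ)|)⁻¹ = ((M : ℝ) + 1)⁻¹ := by
      push_cast
      rw [abs_neg, abs_of_nonneg (by positivity),
        max_eq_right (by linarith [M.cast_nonneg (α := ℝ)])]
    have h3 : (max 1 |((((M : ℤ) + 1 : ℤ)) : ℝ)|)⁻¹ = ((M : ℝ) + 1)⁻¹ := by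
      push_cast
      rw [abs_of_nonneg (by positivity), max_eq_right (by linarith [M.cast_nonneg (α := ℝ)])]
    rw [h2, h3]
    push_cast
    linarith

lemma sum_inv_max_one_abs_sub_le {N : ℕ} (hN : 0 < N) {A : Finset ℤ}
    (hA : A ⊆ Finset.Icc (-(N : ℤ)) N) {n : ℤ} (hn : n ∈ A) :
    ∑ m ∈ A, (max 1 |(n : ℝ) - m|)⁻¹ ≤ 5 * (1 + Real.log N) := by
  have h1 : ∑ m ∈ A, (max 1 |(n : ℝ) - m|)⁻¹
      ≤ ∑ h ∈ Finset.Icc (-((2 * N : ℕ) : ℤ)) ((2 * N : ℕ) : ℤ), (max 1 |(h : ℝ)|)⁻¹ := by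
    have : ∑ m ∈ A, (max 1 |(n : ℝ) - m|)⁻¹
        = ∑ h ∈ A.image (fun m => n - m), (max 1 |(h : ℝ)|)⁻¹ := by
      rw [Finset.sum_image (by intro x _ y _ h; simpa using h)]
      push_cast
      rfl
    rw [this]
    refine Finset.sum_le_sum_of_subset_of_nonneg ?_ fun _ _ _ => by positivity
    intro h hh
    obtain ⟨m, hm, rfl⟩ := Finset.mem_image.1 hh
    have h2 := Finset.mem_Icc.1 (hA hn)
    have h3 := Finset.mem_Icc.1 (hA hm)
    simp only [Finset.mem_Icc]
    push_cast
    constructor <;> linarith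
  refine (h1.trans (sum_inv_max_one_abs_le _)).trans ?_
  have h2 := harmonic_le_one_add_log (2 * N)
  have hN' : (1 : ℝ) ≤ N := by exact_mod_cast hN
  push_cast at h2
  rw [Real.log_mul (by norm_num) (by positivity)] at h2
  have h3 := Real.log_two_lt_d9
  have h4 := Real.log_nonneg hN'
  linarith

lemma expSum_normSq_eq (k : ℕ) (a : ℤ → ℂ) (A : Finset ℤ) (x : ℝ) :
    ((‖expSum k a A x‖ ^ 2 : ℝ) : ℂ) = ∑ n ∈ A, ∑ m ∈ A, (a n * (starRingEnd ℂ) (a m)) *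
      e (((n : ℝ) - m) * (x - ((n : ℝ) + m) * x ^ k)) := by
  push_cast
  rw [← Complex.mul_conj', expSum, map_sum, Finset.sum_mul_sum]
  refine Finset.sum_congr rfl fun n _ => Finset.sum_congr rfl fun m _ => ?_
  rw [map_mul, conj_e, mul_mul_mul_comm, ← e_add]
  congr 2
  ring

lemma integral_expSum_sq_le {k : ℕ} (hk : 2 ≤ k) {N : ℕ} (hN : 0 < N) (a : ℤ → ℂ)
    {A : Finset ℤ} (hA : A ⊆ Finset.Icc (-(N : ℤ)) N) {u v σ : ℝ} (hu : 0 ≤ u) (huv : u ≤ v)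
    (hv : v ≤ 1) (hσ : 0 < σ) (hσ1 : σ ≤ 1)
    (hb : ∀ n ∈ A, ∀ m ∈ A, ∀ x ∈ Set.Ioo u v, σ ≤ |1 - k * ((n : ℝ) + m) * x ^ (k - 1)|) :
    ∫ x in u..v, ‖expSum k a A x‖ ^ 2
      ≤ 5 * (1 + Real.log N) / σ * ∑ n ∈ A, ‖a n‖ ^ 2 := by
  have hcont : ∀ n m : ℤ, Continuous fun x : ℝ => (a n * (starRingEnd ℂ) (a m)) *
      e (((n : ℝ) - m) * (x - ((n : ℝ) + m) * x ^ k)) := fun n m =>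
    continuous_const.mul (continuous_e.comp (by fun_prop))
  have h1 : ((∫ x in u..v, ‖expSum k a A x‖ ^ 2 : ℝ) : ℂ)
      = ∑ n ∈ A, ∑ m ∈ A, (a n * (starRingEnd ℂ) (a m)) *
        ∫ x in u..v, e (((n : ℝ) - m) * (x - ((n : ℝ) + m) * x ^ k)) := by
    rw [← intervalIntegral.integral_ofReal]
    simp_rw [expSum_normSq_eq]
    rw [intervalIntegral.integral_finsetSum fun n _ =>
      (continuous_finsetSum _ fun m _ => hcont n m).intervalIntegrable _ _]
    refine Finset.sum_congr rfl fun n _ => ?_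
    rw [intervalIntegral.integral_finsetSum fun m _ => (hcont n m).intervalIntegrable _ _]
    refine Finset.sum_congr rfl fun m _ => ?_
    rw [intervalIntegral.integral_const_mul]
  have h2 : ∀ n ∈ A, ∀ m ∈ A,
      ‖∫ x in u..v, e (((n : ℝ) - m) * (x - ((n : ℝ) + m) * x ^ k))‖
        ≤ (max 1 |(n : ℝ) - m|)⁻¹ / σ := by
    intro n hn m hm
    rcases eq_or_ne n m with rfl | hnm
    · have : ‖∫ x in u..v, e (((n : ℝ) - n) * (x - ((n : ℝ) + n) * x ^ k))‖ ≤ 1 * |v - u| :=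
        intervalIntegral.norm_integral_le_of_norm_le_const fun x _ => (norm_e _).le
      refine this.trans ?_
      rw [one_mul, abs_of_nonneg (by linarith)]
      simp only [sub_self, abs_zero, zero_le_one, sup_of_le_left, inv_one]
      rw [le_div_iff₀ hσ]
      nlinarith
    · have h0 : (n : ℝ) - m ≠ 0 := sub_ne_zero.2 (by exact_mod_cast hnm)
      refine (norm_integral_e_monomial_le hk h0 hu huv hσ (hb n hn m hm)).trans ?_
      have h1 : (1 : ℝ) ≤ |(n : ℝ) - m| := by
        have : (1 : ℤ) ≤ |n - m| := Int.one_le_abs (sub_ne_zero.2 hnm)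
        exact_mod_cast this
      rw [max_eq_right h1, one_div, mul_inv, div_eq_mul_inv]
  have h3 : ∫ x in u..v, ‖expSum k a A x‖ ^ 2
      ≤ ∑ n ∈ A, ∑ m ∈ A, (‖a n‖ * ‖a m‖) * ((max 1 |(n : ℝ) - m|)⁻¹ / σ) := by
    calc ∫ x in u..v, ‖expSum k a A x‖ ^ 2
        ≤ ‖((∫ x in u..v, ‖expSum k a A x‖ ^ 2 : ℝ) : ℂ)‖ := by
          rw [Complex.norm_real]; exact le_abs_self _
      _ ≤ _ := by
          rw [h1]
          refine norm_sum_le_of_le _ fun n hn => norm_sum_le_of_le _ fun m hm => ?_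
          rw [norm_mul, norm_mul, RCLike.norm_conj]
          exact mul_le_mul_of_nonneg_left (h2 n hn m hm) (by positivity)
  refine h3.trans ?_
  have h4 : ∑ n ∈ A, ∑ m ∈ A, (‖a n‖ * ‖a m‖) * ((max 1 |(n : ℝ) - m|)⁻¹ / σ)
      ≤ ∑ n ∈ A, ∑ m ∈ A, (‖a n‖ ^ 2 / 2 + ‖a m‖ ^ 2 / 2) * ((max 1 |(n : ℝ) - m|)⁻¹ / σ) := by
    refine Finset.sum_le_sum fun n _ => Finset.sum_le_sum fun m _ => ?_
    refine mul_le_mul_of_nonneg_right ?_ (by positivity)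
    nlinarith [sq_nonneg (‖a n‖ - ‖a m‖)]
  have h5 : ∑ n ∈ A, ∑ m ∈ A, (‖a n‖ ^ 2 / 2 + ‖a m‖ ^ 2 / 2) * ((max 1 |(n : ℝ) - m|)⁻¹ / σ)
      = ∑ n ∈ A, ‖a n‖ ^ 2 * ((∑ m ∈ A, (max 1 |(n : ℝ) - m|)⁻¹) / σ) := by
    have h6 : ∑ n ∈ A, ∑ m ∈ A, ‖a m‖ ^ 2 / 2 * ((max 1 |(n : ℝ) - m|)⁻¹ / σ)
        = ∑ n ∈ A, ∑ m ∈ A, ‖a n‖ ^ 2 / 2 * ((max 1 |(n : ℝ) - m|)⁻¹ / σ) := by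
      rw [Finset.sum_comm]
      simp_rw [abs_sub_comm]
    simp_rw [add_mul, Finset.sum_add_distrib]
    rw [h6, ← Finset.sum_add_distrib]
    refine Finset.sum_congr rfl fun n _ => ?_
    rw [← Finset.mul_sum, Finset.sum_div]
    ring
  rw [h5] at h4
  refine h4.trans ?_
  rw [Finset.mul_sum]
  refine Finset.sum_le_sum fun n hn => ?_
  rw [mul_comm]
  refine mul_le_mul_of_nonneg_right ?_ (by positivity)
  exact div_le_div_of_nonneg_right (sum_inv_max_one_abs_sub_le hN hA hn) hσ.le

lemma norm_expSum_sq_le (k : ℕ) (a : ℤ → ℂ) (A : Finset ℤ) (x : ℝ) :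
    ‖expSum k a A x‖ ^ 2 ≤ A.card * ∑ n ∈ A, ‖a n‖ ^ 2 := by
  have h1 : ‖expSum k a A x‖ ≤ ∑ n ∈ A, ‖a n‖ := by
    refine norm_sum_le_of_le _ fun n _ => ?_
    rw [norm_mul, norm_e, mul_one]
  exact (pow_le_pow_left₀ (norm_nonneg _) h1 2).trans sq_sum_le_card_mul_sum_sq

lemma exists_Ioc_ae_eq {J : Set ℝ} (hJ : J.OrdConnected) (hJ1 : J ⊆ Set.Ioo 0 1) :
    ∃ u v : ℝ, 0 ≤ u ∧ u ≤ v ∧ v ≤ 1 ∧ Set.Ioo u v ⊆ J ∧ J =ᵐ[volume] Set.Ioc u v := by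
  rcases J.eq_empty_or_nonempty with rfl | hne
  · exact ⟨0, 0, le_rfl, le_rfl, zero_le_one, by simp, by simp⟩
  have hbb : BddBelow J := ⟨0, fun x hx => (hJ1 hx).1.le⟩
  have hba : BddAbove J := ⟨1, fun x hx => (hJ1 hx).2.le⟩
  have hsub : Set.Ioo (sInf J) (sSup J) ⊆ J :=
    IsConnected.Ioo_csInf_csSup_subset ⟨hne, hJ.isPreconnected⟩ hbb hba
  refine ⟨sInf J, sSup J, le_csInf hne fun x hx => (hJ1 hx).1.le, csInf_le_csSup hne hbb hba,
    csSup_le hne fun x hx => (hJ1 hx).2.le, hsub, ?_⟩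
  have hsup : J ⊆ Set.Icc (sInf J) (sSup J) := fun x hx => ⟨csInf_le hbb hx, le_csSup hba hx⟩
  refine Filter.EventuallyLE.antisymm ?_ ?_
  · exact hsup.eventuallyLE.trans Ioc_ae_eq_Icc.symm.le
  · exact Ioo_ae_eq_Ioc.symm.le.trans hsub.eventuallyLE

lemma enorm_expSum_rpow_le (k : ℕ) (a : ℤ → ℂ) (A : Finset ℤ) {p B W : ℝ} (hp : 2 ≤ p)
    (hB : (A.card : ℝ) ≤ B) (hW : ∑ n ∈ A, ‖a n‖ ^ 2 ≤ W) (x : ℝ) :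
    ‖expSum k a A x‖ₑ ^ p
      ≤ ENNReal.ofReal ((B * W) ^ ((p - 2) / 2) * ‖expSum k a A x‖ ^ 2) := by
  rw [← ofReal_norm, ENNReal.ofReal_rpow_of_nonneg (norm_nonneg _) (by linarith)]
  refine ENNReal.ofReal_le_ofReal ?_
  have h1 : ‖expSum k a A x‖ ^ p
      = (‖expSum k a A x‖ ^ 2) ^ ((p - 2) / 2) * ‖expSum k a A x‖ ^ 2 := by
    rw [← Real.rpow_natCast, ← Real.rpow_mul (norm_nonneg _),
      ← Real.rpow_add_of_nonneg (norm_nonneg _) (by push_cast; linarith) (by norm_num)]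
    congr 1
    push_cast; ring
  rw [h1]
  refine mul_le_mul_of_nonneg_right (Real.rpow_le_rpow (by positivity) ?_ (by linarith))
    (by positivity)
  refine (norm_expSum_sq_le k a A x).trans (mul_le_mul hB hW (by positivity) ?_)
  exact (Nat.cast_nonneg _).trans hB

/-- On a box where the mixed derivative of the phase is at least `σ`, the `L^p` norm is controlled
by orthogonality and the trivial sup bound. -/
lemma lintegral_expSum_le_of_separated {k : ℕ} (hk : 2 ≤ k) {N : ℕ} (hN : 0 < N) (a : ℤ → ℂ)
    {A : Finset ℤ} (hA : A ⊆ Finset.Icc (-(N : ℤ)) N) {J : Set ℝ} (hJ : J.OrdConnected)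
    (hJ1 : J ⊆ Set.Ioo 0 1) {p B W σ : ℝ} (hp : 2 ≤ p) (hσ : 0 < σ) (hσ1 : σ ≤ 1)
    (hB : (A.card : ℝ) ≤ B) (hW : ∑ n ∈ A, ‖a n‖ ^ 2 ≤ W)
    (hb : ∀ n ∈ A, ∀ m ∈ A, ∀ x ∈ J, σ ≤ |1 - k * ((n : ℝ) + m) * x ^ (k - 1)|) :
    ∫⁻ x in J, ‖expSum k a A x‖ₑ ^ p
      ≤ ENNReal.ofReal ((B * W) ^ ((p - 2) / 2) * (5 * (1 + Real.log N) / σ)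
          * ∑ n ∈ A, ‖a n‖ ^ 2) := by
  obtain ⟨u, v, hu, huv, hv, hsub, hae⟩ := exists_Ioc_ae_eq hJ hJ1
  have hB0 : 0 ≤ B := (Nat.cast_nonneg _).trans hB
  have hW0 : 0 ≤ W := le_trans (by positivity) hW
  have hint : IntegrableOn (fun x => (B * W) ^ ((p - 2) / 2) * ‖expSum k a A x‖ ^ 2)
      (Set.Ioc u v) :=
    (((continuous_expSum k a A).norm.pow 2).const_mul _).integrableOn_Ioc
  rw [Measure.restrict_congr_set hae]
  refine (lintegral_mono fun x => enorm_expSum_rpow_le k a A hp hB hW x).trans ?_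
  rw [← ofReal_integral_eq_lintegral_ofReal hint
    (Filter.Eventually.of_forall fun x => by positivity)]
  refine ENNReal.ofReal_le_ofReal ?_
  rw [← intervalIntegral.integral_of_le huv, intervalIntegral.integral_const_mul, mul_assoc]
  refine mul_le_mul_of_nonneg_left ?_ (by positivity)
  exact integral_expSum_sq_le hk hN a hA hu huv hv hσ hσ1
    fun n hn m hm x hx => hb n hn m hm x (hsub hx)

lemma lintegral_expSum_le_of_volume_le (k : ℕ) (a : ℤ → ℂ) (A : Finset ℤ) {J : Set ℝ}
    {p B W V : ℝ} (hp : 2 ≤ p) (hV : volume J ≤ ENNReal.ofReal V) (hB : (A.card : ℝ) ≤ B)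
    (hW : ∑ n ∈ A, ‖a n‖ ^ 2 ≤ W) :
    ∫⁻ x in J, ‖expSum k a A x‖ₑ ^ p
      ≤ ENNReal.ofReal ((B * W) ^ ((p - 2) / 2) * (V * B) * ∑ n ∈ A, ‖a n‖ ^ 2) := by
  have hB0 : 0 ≤ B := (Nat.cast_nonneg _).trans hB
  have hW0 : 0 ≤ W := le_trans (by positivity) hW
  have h1 : ∀ x, ‖expSum k a A x‖ₑ ^ p
      ≤ ENNReal.ofReal ((B * W) ^ ((p - 2) / 2) * (B * ∑ n ∈ A, ‖a n‖ ^ 2)) := fun x => by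
    refine (enorm_expSum_rpow_le k a A hp hB hW x).trans (ENNReal.ofReal_le_ofReal ?_)
    refine mul_le_mul_of_nonneg_left ?_ (by positivity)
    exact (norm_expSum_sq_le k a A x).trans (mul_le_mul_of_nonneg_right hB (by positivity))
  refine (lintegral_mono h1).trans ?_
  rw [setLIntegral_const]
  refine (mul_le_mul_right hV _).trans ?_
  rw [← ENNReal.ofReal_mul (by positivity)]
  refine ENNReal.ofReal_le_ofReal (le_of_eq ?_)
  ring

lemma measurable_expSum_comp (k : ℕ) (a : ℤ → ℂ) (A : ℤ → Finset ℤ) {b : ℝ → ℤ}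
    (hb : Measurable b) : Measurable fun x => expSum k a (A (b x)) x := by
  have h : Measurable fun z : ℤ × ℝ => expSum k a (A z.1) z.2 := by
    refine measurable_from_prod_countable_right fun t => ?_
    exact (continuous_expSum k a (A t)).measurable
  have h2 : Measurable fun x : ℝ => (b x, x) := Measurable.prodMk hb measurable_id
  have h3 := Measurable.comp h h2
  exact h3

lemma lintegral_expSum_comp_le (k : ℕ) (a : ℤ → ℂ) (A : ℤ → Finset ℤ) {b : ℝ → ℤ}
    (hb : Measurable b) (T : Finset ℤ) {p Q : ℝ} (hp : 0 < p) (hQ : 0 ≤ Q)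
    (hT : ∀ x ∈ Set.Ioo (0 : ℝ) 1, b x ∉ T → A (b x) = ∅)
    (hbox : ∀ t ∈ T, ∫⁻ x in Set.Ioo 0 1 ∩ b ⁻¹' {t}, ‖expSum k a (A t) x‖ₑ ^ p
      ≤ ENNReal.ofReal (Q * ∑ n ∈ A t, ‖a n‖ ^ 2)) :
    ∫⁻ x in Set.Ioo 0 1, ‖expSum k a (A (b x)) x‖ₑ ^ p
      ≤ ENNReal.ofReal (Q * ∑ t ∈ T, ∑ n ∈ A t, ‖a n‖ ^ 2) := by
  have hms : ∀ t, MeasurableSet (b ⁻¹' {t}) := fun t => hb (measurableSet_singleton t)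
  have hmf : ∀ t, Measurable fun x => ‖expSum k a (A t) x‖ₑ ^ p := fun t =>
    (continuous_expSum k a (A t)).measurable.enorm.pow_const p
  calc ∫⁻ x in Set.Ioo 0 1, ‖expSum k a (A (b x)) x‖ₑ ^ p
      ≤ ∫⁻ x in Set.Ioo 0 1, ∑ t ∈ T,
          (b ⁻¹' {t}).indicator (fun x => ‖expSum k a (A t) x‖ₑ ^ p) x := by
        refine setLIntegral_mono' measurableSet_Ioo fun x hx => ?_
        by_cases hxT : b x ∈ T
        · refine le_trans (le_of_eq ?_) (Finset.single_le_sum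
            (f := fun t => (b ⁻¹' {t}).indicator (fun x => ‖expSum k a (A t) x‖ₑ ^ p) x)
            (fun _ _ => zero_le) hxT)
          simp
        · rw [hT x hx hxT]
          simp [expSum, hp]
    _ = ∑ t ∈ T, ∫⁻ x in Set.Ioo 0 1 ∩ b ⁻¹' {t}, ‖expSum k a (A t) x‖ₑ ^ p := by
        rw [lintegral_finsetSum _ fun t _ => (hmf t).indicator (hms t)]
        refine Finset.sum_congr rfl fun t _ => ?_
        rw [lintegral_indicator (hms t), Measure.restrict_restrict (hms t), Set.inter_comm]
    _ ≤ ∑ t ∈ T, ENNReal.ofReal (Q * ∑ n ∈ A t, ‖a n‖ ^ 2) := Finset.sum_le_sum hbox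
    _ = _ := by
        rw [← ENNReal.ofReal_sum_of_nonneg fun _ _ => by positivity, Finset.mul_sum]

/-- Logarithm of the frequency at which the mixed derivative of the phase vanishes at `x`. -/
noncomputable def logCrit (k : ℕ) (x : ℝ) : ℝ := -Real.log (2 * k * x ^ (k - 1))

/-- Index of the dyadic interval of length `2⁻ʲ` containing `t`. -/
noncomputable def dyadicIndex (j : ℕ) (t : ℝ) : ℤ := ⌊(2 : ℝ) ^ j * t⌋

/-- Positive frequencies up to `N` whose logarithm lies in the `t`-th dyadic interval of
length `2⁻ʲ`. -/
noncomputable def logFiber (N j : ℕ) (t : ℤ) : Finset ℤ :=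
  (Finset.Icc (1 : ℤ) N).filter fun n => dyadicIndex j (Real.log n) = t

lemma dyadicIndex_mono (j : ℕ) : Monotone (dyadicIndex j) := fun s t h =>
  Int.floor_mono (by gcongr)

lemma measurable_dyadicIndex (j : ℕ) : Measurable (dyadicIndex j) :=
  (measurable_id.const_mul _).floor

lemma dyadicIndex_eq_succ_div (j : ℕ) (t : ℝ) : dyadicIndex j t = dyadicIndex (j + 1) t / 2 := by
  have h := Int.floor_div_natCast ((2 : ℝ) ^ (j + 1) * t) 2
  rw [dyadicIndex, dyadicIndex]
  push_cast at h
  rw [← h]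
  congr 1
  rw [pow_succ]; ring

lemma add_le_of_dyadicIndex_add_two_le {j : ℕ} {s t : ℝ}
    (h : dyadicIndex j s + 2 ≤ dyadicIndex j t) : s + (1 / 2) ^ j ≤ t := by
  have h1 := Int.lt_floor_add_one ((2 : ℝ) ^ j * s)
  have h2 := Int.floor_le ((2 : ℝ) ^ j * t)
  have h3 : ((dyadicIndex j s : ℤ) : ℝ) + 2 ≤ dyadicIndex j t := by exact_mod_cast h
  rw [dyadicIndex, dyadicIndex] at h3
  have h4 : (2 : ℝ) ^ j * (1 / 2) ^ j = 1 := by rw [← mul_pow]; norm_num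
  have h5 : (0 : ℝ) < 2 ^ j := by positivity
  nlinarith

lemma sub_lt_of_dyadicIndex_le_add {j : ℕ} {s t : ℝ} {d : ℤ}
    (h : dyadicIndex j t ≤ dyadicIndex j s + d) : t - s < (d + 1) * (1 / 2) ^ j := by
  have h1 := Int.lt_floor_add_one ((2 : ℝ) ^ j * t)
  have h2 := Int.floor_le ((2 : ℝ) ^ j * s)
  have h3 : ((dyadicIndex j t : ℤ) : ℝ) ≤ dyadicIndex j s + d := by exact_mod_cast h
  rw [dyadicIndex, dyadicIndex] at h3
  have h4 : (2 : ℝ) ^ j * (1 / 2) ^ j = 1 := by rw [← mul_pow]; norm_num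
  have h5 : (0 : ℝ) < 2 ^ j := by positivity
  refine lt_of_mul_lt_mul_left ?_ h5.le
  calc (2 : ℝ) ^ j * (t - s) < d + 1 := by linarith
    _ = (2 : ℝ) ^ j * ((d + 1) * (1 / 2) ^ j) := by linear_combination -(d + 1 : ℝ) * h4

lemma measurable_logCrit (k : ℕ) : Measurable (logCrit k) := by
  unfold logCrit; fun_prop

lemma antitoneOn_logCrit {k : ℕ} (hk : 2 ≤ k) : AntitoneOn (logCrit k) (Set.Ioo 0 1) := by
  intro x hx y hy hxy
  have hk0 : (0 : ℝ) < k := by positivity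
  have hx0 := hx.1
  unfold logCrit
  gcongr

lemma ordConnected_inter_preimage {b : ℝ → ℤ} (hb : AntitoneOn b (Set.Ioo 0 1)) (t : ℤ) :
    (Set.Ioo (0 : ℝ) 1 ∩ b ⁻¹' {t}).OrdConnected := by
  refine ⟨fun x hx y hy z hz => ?_⟩
  have hz1 : z ∈ Set.Ioo (0 : ℝ) 1 := ⟨hx.1.1.trans_le hz.1, hz.2.trans_lt hy.1.2⟩
  refine ⟨hz1, le_antisymm ?_ ?_⟩
  · exact (hb hx.1 hz1 hz.1).trans hx.2.le
  · exact (hy.2.symm.le).trans (hb hz1 hy.1 hz.2)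

lemma exp_neg_le_one_sub_half {δ : ℝ} (h0 : 0 ≤ δ) (h1 : δ ≤ 1) : Real.exp (-δ) ≤ 1 - δ / 2 := by
  rw [Real.exp_neg]
  refine inv_le_of_inv_le₀ (by linarith) ?_
  have h2 := Real.add_one_le_exp δ
  refine le_trans ?_ h2
  rw [inv_le_iff_one_le_mul₀ (by linarith)]
  nlinarith

lemma half_le_abs_of_log_separated {k : ℕ} (hk : 2 ≤ k) {x δ u v : ℝ} (hx : 0 < x) (hu : 0 < u)
    (hv : 0 < v) (hδ : 0 < δ) (hδ1 : δ ≤ 1)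
    (h : (logCrit k x + δ ≤ Real.log u ∧ logCrit k x + δ ≤ Real.log v) ∨
      (Real.log u + δ ≤ logCrit k x ∧ Real.log v + δ ≤ logCrit k x)) :
    δ / 2 ≤ |1 - k * (u + v) * x ^ (k - 1)| := by
  have hk0 : (0 : ℝ) < k := by positivity
  have hy : 0 < 2 * k * x ^ (k - 1) := by positivity
  set y := 2 * k * x ^ (k - 1) with hydef
  have hc : logCrit k x = -Real.log y := rfl
  have heq : k * (u + v) * x ^ (k - 1) = (u * y + v * y) / 2 := by rw [hydef]; ring
  rw [heq]
  have hlog : ∀ w, 0 < w → Real.log (w * y) = Real.log w + Real.log y := fun w hw =>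
    Real.log_mul hw.ne' hy.ne'
  rw [hc] at h
  rcases h with ⟨h1, h2⟩ | ⟨h1, h2⟩
  · have key : ∀ w, 0 < w → -Real.log y + δ ≤ Real.log w → 1 + δ ≤ w * y := fun w hw h => by
      have : δ ≤ Real.log (w * y) := by rw [hlog w hw]; linarith
      rw [Real.le_log_iff_exp_le (by positivity)] at this
      linarith [Real.add_one_le_exp δ]
    have := key u hu h1
    have := key v hv h2
    rw [abs_of_nonpos (by linarith)]
    linarith
  · have key : ∀ w, 0 < w → Real.log w + δ ≤ -Real.log y → w * y ≤ 1 - δ / 2 := fun w hw h => by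
      have : Real.log (w * y) ≤ -δ := by rw [hlog w hw]; linarith
      rw [Real.log_le_iff_le_exp (by positivity)] at this
      exact this.trans (exp_neg_le_one_sub_half hδ.le hδ1)
    have := key u hu h1
    have := key v hv h2
    rw [abs_of_nonneg (by linarith)]
    linarith

lemma le_mul_of_log_sub_le {u v δ : ℝ} (hu : 0 < u) (hv : 0 < v) (hδ : 0 ≤ δ) (hδ1 : δ ≤ 1)
    (h : Real.log v - Real.log u ≤ δ) : v ≤ u * (1 + 2 * δ) := by
  rw [← Real.log_div hv.ne' hu.ne', Real.log_le_iff_le_exp (by positivity), div_le_iff₀ hu] at h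
  have h1 := Real.abs_exp_sub_one_le (x := δ) (by rwa [abs_of_nonneg hδ])
  rw [abs_of_nonneg hδ] at h1
  have h2 := (abs_le.1 h1).2
  nlinarith

lemma card_logFiber_le {N j : ℕ} {t n : ℤ} (hn : n ∈ logFiber N j t) :
    ((logFiber N j t).card : ℝ) ≤ 1 + 2 * (1 / 2) ^ j * n := by
  set A := logFiber N j t with hA
  have hne : A.Nonempty := ⟨n, hn⟩
  have hmem : ∀ m ∈ A, 1 ≤ m ∧ dyadicIndex j (Real.log m) = t := fun m hm => by
    have := Finset.mem_filter.1 hm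
    exact ⟨(Finset.mem_Icc.1 this.1).1, this.2⟩
  have hmin := hmem _ (A.min'_mem hne)
  have hmax := hmem _ (A.max'_mem hne)
  have hsub : A ⊆ Finset.Icc (A.min' hne) (A.max' hne) := fun m hm =>
    Finset.mem_Icc.2 ⟨A.min'_le m hm, A.le_max' m hm⟩
  have hcard := Finset.card_le_card hsub
  rw [Int.card_Icc] at hcard
  have hle : A.min' hne ≤ A.max' hne := A.min'_le _ (A.max'_mem hne)
  have hcard' : (A.card : ℤ) ≤ A.max' hne + 1 - A.min' hne := by omega
  have hcardR : (A.card : ℝ) ≤ A.max' hne + 1 - A.min' hne := by exact_mod_cast hcard'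
  have hlog : Real.log (A.max' hne) - Real.log (A.min' hne) ≤ (1 / 2) ^ j := by
    have := sub_lt_of_dyadicIndex_le_add (j := j) (s := Real.log (A.min' hne))
      (t := Real.log (A.max' hne)) (d := 0) (by rw [hmin.2, hmax.2]; simp)
    simp only [Int.cast_zero, zero_add, one_mul] at this
    exact this.le
  have h1 : (1 : ℝ) ≤ A.min' hne := by exact_mod_cast hmin.1
  have h2 : (1 : ℝ) ≤ A.max' hne := by exact_mod_cast hmax.1
  have h3 := le_mul_of_log_sub_le (by linarith) (by linarith) (by positivity)
    (pow_le_one₀ (by norm_num) (by norm_num)) hlog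
  have h4 : ((A.min' hne : ℤ) : ℝ) ≤ n := by exact_mod_cast A.min'_le n hn
  have h5 : (0 : ℝ) < (1 / 2) ^ j := by positivity
  nlinarith

lemma logFiber_subset (N j : ℕ) (t : ℤ) : logFiber N j t ⊆ Finset.Icc (-(N : ℤ)) N := by
  intro n hn
  have := Finset.mem_Icc.1 (Finset.mem_filter.1 hn).1
  simp only [Finset.mem_Icc]
  omega

lemma sum_logFiber_le (a : ℤ → ℂ) (N j : ℕ) (d : ℤ) {A : ℤ → Finset ℤ}
    (hA : ∀ t, A t ⊆ logFiber N j (t + d)) :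
    ∑ t ∈ (Finset.Icc (1 : ℤ) N).image (fun n : ℤ => dyadicIndex j (Real.log n) - d),
      ∑ n ∈ A t, ‖a n‖ ^ 2 ≤ ∑ n ∈ Finset.Icc (-(N : ℤ)) N, ‖a n‖ ^ 2 := by
  calc _ ≤ ∑ t ∈ (Finset.Icc (1 : ℤ) N).image (fun n : ℤ => dyadicIndex j (Real.log n) - d),
        ∑ n ∈ (Finset.Icc (1 : ℤ) N).filter
          (fun n : ℤ => dyadicIndex j (Real.log n) - d = t), ‖a n‖ ^ 2 := by
        refine Finset.sum_le_sum fun t _ => Finset.sum_le_sum_of_subset_of_nonneg ?_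
          fun _ _ _ => by positivity
        intro n hn
        have h := Finset.mem_filter.1 (hA t hn)
        exact Finset.mem_filter.2 ⟨h.1, by rw [h.2]; ring⟩
    _ = ∑ n ∈ Finset.Icc (1 : ℤ) N, ‖a n‖ ^ 2 :=
        Finset.sum_fiberwise_of_maps_to (fun n hn => Finset.mem_image_of_mem _ hn) _
    _ ≤ _ := by
        refine Finset.sum_le_sum_of_subset_of_nonneg (Finset.Icc_subset_Icc (by omega) le_rfl)
          fun _ _ _ => by positivity

lemma eq_empty_of_notMem_image {N j : ℕ} {d : ℤ} {A : ℤ → Finset ℤ}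
    (hA : ∀ t, A t ⊆ logFiber N j (t + d)) {t : ℤ}
    (ht : t ∉ (Finset.Icc (1 : ℤ) N).image (fun n : ℤ => dyadicIndex j (Real.log n) - d)) :
    A t = ∅ := by
  rw [Finset.eq_empty_iff_forall_notMem]
  intro n hn
  have h := Finset.mem_filter.1 (hA t hn)
  exact ht (Finset.mem_image.2 ⟨n, h.1, by rw [h.2]; ring⟩)

lemma ediam_le_of_logCrit {k : ℕ} (hk : 2 ≤ k) {j : ℕ} {t n : ℤ} (hn : 1 ≤ n)
    (hnt : |dyadicIndex j (Real.log n) - t| ≤ 1) :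
    volume (Set.Ioo (0 : ℝ) 1 ∩ (fun x => dyadicIndex j (logCrit k x)) ⁻¹' {t})
      ≤ ENNReal.ofReal (16 * (1 / 2) ^ j * (n : ℝ) ^ (-(1 / ((k : ℝ) - 1)))) := by
  have hδ : (0 : ℝ) < (1 / 2) ^ j := by positivity
  have hδ1 : ((1 : ℝ) / 2) ^ j ≤ 1 := pow_le_one₀ (by norm_num) (by norm_num)
  have hn1 : (1 : ℝ) ≤ n := by exact_mod_cast hn
  have hk1 : (1 : ℝ) ≤ (k : ℝ) - 1 := by
    have : (2 : ℝ) ≤ k := by exact_mod_cast hk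
    linarith
  have hkc : ((k - 1 : ℕ) : ℝ) = (k : ℝ) - 1 := by
    rw [Nat.cast_sub (by omega)]; simp
  have hlog : ∀ x : ℝ, 0 < x →
      logCrit k x = -(Real.log (2 * k) + ((k : ℝ) - 1) * Real.log x) := fun x hx => by
    have : (0 : ℝ) < k := by positivity
    rw [logCrit, Real.log_mul (by positivity) (by positivity), Real.log_pow, hkc]
  refine (Real.volume_le_diam _).trans (Metric.ediam_le_of_forall_dist_le ?_)
  have key : ∀ x ∈ Set.Ioo (0 : ℝ) 1 ∩ (fun x => dyadicIndex j (logCrit k x)) ⁻¹' {t},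
      ∀ y ∈ Set.Ioo (0 : ℝ) 1 ∩ (fun x => dyadicIndex j (logCrit k x)) ⁻¹' {t},
      y - x ≤ 16 * (1 / 2) ^ j * (n : ℝ) ^ (-(1 / ((k : ℝ) - 1))) := by
    rintro x ⟨⟨hx0, hx1⟩, hx⟩ y ⟨⟨hy0, hy1⟩, hy⟩
    have hx' : dyadicIndex j (logCrit k x) = t := hx
    have hy' : dyadicIndex j (logCrit k y) = t := hy
    rw [abs_le] at hnt
    have h1 := sub_lt_of_dyadicIndex_le_add (j := j) (s := logCrit k y) (t := logCrit k x) (d := 0)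
      (by rw [hx', hy']; simp)
    have h2 := sub_lt_of_dyadicIndex_le_add (j := j) (s := logCrit k x) (t := Real.log n) (d := 1)
      (by rw [hx']; linarith)
    simp only [Int.cast_zero, zero_add, one_mul, Int.cast_one] at h1 h2
    rw [hlog x hx0] at h2
    rw [hlog x hx0, hlog y hy0] at h1
    have h3 : Real.log y - Real.log x ≤ (1 / 2) ^ j := by nlinarith
    have h4 := le_mul_of_log_sub_le hx0 hy0 hδ.le hδ1 h3
    have h5 : Real.log x ≤ 2 + Real.log n * (-(1 / ((k : ℝ) - 1))) := by
      have h6 : 0 ≤ Real.log (2 * k) := Real.log_nonneg (by linarith)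
      have h7 : ((k : ℝ) - 1) * Real.log x ≤ 2 - Real.log n := by
        linarith
      have h8 : Real.log x ≤ (2 - Real.log n) / ((k : ℝ) - 1) := by
        rw [le_div_iff₀ (by linarith)]; linarith
      have h9 : (2 : ℝ) / ((k : ℝ) - 1) ≤ 2 := div_le_self (by norm_num) hk1
      calc Real.log x ≤ _ := h8
        _ = 2 / ((k : ℝ) - 1) + Real.log n * (-(1 / ((k : ℝ) - 1))) := by ring
        _ ≤ _ := by linarith
    have h6 : x ≤ 8 * (n : ℝ) ^ (-(1 / ((k : ℝ) - 1))) := by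
      rw [Real.log_le_iff_le_exp hx0, Real.exp_add, ← Real.rpow_def_of_pos (by linarith)] at h5
      refine h5.trans (mul_le_mul_of_nonneg_right ?_ (by positivity))
      have := Real.exp_one_lt_d9
      have h7 : Real.exp 2 = Real.exp 1 * Real.exp 1 := by rw [← Real.exp_add]; norm_num
      rw [h7]
      nlinarith [Real.exp_pos 1]
    nlinarith
  intro x hx y hy
  rw [Real.dist_eq, abs_le]
  constructor
  · linarith [key x hx y hy]
  · exact key y hy x hx

lemma rpow_div_le_of_scale {N q κ δ : ℝ} (hN : 1 ≤ N) (hq1 : q ≤ 1) (hδ0 : 0 < δ)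
    (hδ : δ⁻¹ ≤ N ^ ((1 - κ) / 3)) :
    (3 * δ * N) ^ q / δ ≤ 3 * N ^ (q + (1 - κ) * (1 - q) / 3) := by
  have hN0 : 0 < N := by linarith
  have h1 : (3 * δ * N) ^ q / δ = 3 ^ q * N ^ q * (δ⁻¹) ^ (1 - q) := by
    rw [Real.mul_rpow (by positivity) hN0.le, Real.mul_rpow (by norm_num) hδ0.le,
      Real.inv_rpow hδ0.le, ← Real.rpow_neg hδ0.le, neg_sub, Real.rpow_sub_one hδ0.ne']
    ring
  rw [h1, Real.rpow_add hN0, ← mul_assoc]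
  have h2 : (3 : ℝ) ^ q ≤ 3 := by
    calc (3 : ℝ) ^ q ≤ 3 ^ (1 : ℝ) := Real.rpow_le_rpow_of_exponent_le (by norm_num) hq1
      _ = 3 := Real.rpow_one _
  have h3 : (δ⁻¹) ^ (1 - q) ≤ N ^ ((1 - κ) * (1 - q) / 3) := by
    calc (δ⁻¹) ^ (1 - q) ≤ (N ^ ((1 - κ) / 3)) ^ (1 - q) :=
          Real.rpow_le_rpow (by positivity) hδ (by linarith)
      _ = _ := by rw [← Real.rpow_mul hN0.le]; congr 1; ring
  gcongr

lemma rpow_mul_min_le_of_scale {N n q κ δ : ℝ} (hn : 1 ≤ n) (hnN : n ≤ N) (hq : 0 ≤ q)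
    (hq1 : q ≤ 1) (hκ1 : κ ≤ 1) (hδ0 : 0 < δ) (hδ : δ * N ^ ((1 - κ) / 3) ≤ 2) :
    (1 + 2 * δ * n) ^ q * (min 1 (16 * δ * n ^ (-κ)) * (1 + 2 * δ * n))
      ≤ 2048 * N ^ (q + (1 - κ) * (1 - q) / 3) := by
  have hn0 : 0 < n := by linarith
  have hN : 1 ≤ N := hn.trans hnN
  have hN0 : 0 < N := by linarith
  have hE : 1 ≤ N ^ (q + (1 - κ) * (1 - q) / 3) := Real.one_le_rpow hN (by
    have : 0 ≤ (1 - κ) * (1 - q) := mul_nonneg (by linarith) (by linarith)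
    linarith)
  have hcomb : (1 + 2 * δ * n) ^ q * (min 1 (16 * δ * n ^ (-κ)) * (1 + 2 * δ * n))
      = min 1 (16 * δ * n ^ (-κ)) * (1 + 2 * δ * n) ^ (q + 1) := by
    rw [Real.rpow_add_one (by positivity)]; ring
  rw [hcomb]
  rcases le_total (2 * δ * n) 1 with h | h
  · have h1 : (1 + 2 * δ * n) ^ (q + 1) ≤ 4 := by
      calc (1 + 2 * δ * n) ^ (q + 1) ≤ 2 ^ (q + 1) :=
            Real.rpow_le_rpow (by positivity) (by linarith) (by linarith)
        _ ≤ 2 ^ (2 : ℝ) := Real.rpow_le_rpow_of_exponent_le (by norm_num) (by linarith)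
        _ = 4 := by norm_num
    have h2 : min 1 (16 * δ * n ^ (-κ)) ≤ 1 := min_le_left _ _
    have h3 : 0 ≤ min 1 (16 * δ * n ^ (-κ)) := le_min zero_le_one (by positivity)
    have h4 : 0 ≤ (1 + 2 * δ * n) ^ (q + 1) := by positivity
    nlinarith
  · have h1 : (1 + 2 * δ * n) ^ (q + 1) ≤ 16 * (δ ^ (q + 1) * n ^ (q + 1)) := by
      calc (1 + 2 * δ * n) ^ (q + 1) ≤ (4 * (δ * n)) ^ (q + 1) :=
            Real.rpow_le_rpow (by positivity) (by linarith) (by linarith)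
        _ = 4 ^ (q + 1) * (δ ^ (q + 1) * n ^ (q + 1)) := by
            rw [Real.mul_rpow (by norm_num) (by positivity), Real.mul_rpow hδ0.le hn0.le]
        _ ≤ 4 ^ (2 : ℝ) * (δ ^ (q + 1) * n ^ (q + 1)) := by
            refine mul_le_mul_of_nonneg_right ?_ (by positivity)
            exact Real.rpow_le_rpow_of_exponent_le (by norm_num) (by linarith)
        _ = _ := by norm_num
    have h2 : δ ≤ 2 * N ^ (-((1 - κ) / 3)) := by
      rw [Real.rpow_neg hN0.le, ← div_eq_mul_inv, le_div_iff₀ (by positivity)]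
      exact hδ
    have h3 : δ ^ (q + 2) ≤ 8 * N ^ (-((1 - κ) / 3) * (q + 2)) := by
      calc δ ^ (q + 2) ≤ (2 * N ^ (-((1 - κ) / 3))) ^ (q + 2) :=
            Real.rpow_le_rpow hδ0.le h2 (by linarith)
        _ = 2 ^ (q + 2) * N ^ (-((1 - κ) / 3) * (q + 2)) := by
            rw [Real.mul_rpow (by norm_num) (by positivity), ← Real.rpow_mul hN0.le]
        _ ≤ 2 ^ (3 : ℝ) * N ^ (-((1 - κ) / 3) * (q + 2)) := by
            refine mul_le_mul_of_nonneg_right ?_ (by positivity)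
            exact Real.rpow_le_rpow_of_exponent_le (by norm_num) (by linarith)
        _ = _ := by norm_num
    have h4 : n ^ (q + 1 - κ) ≤ N ^ (q + 1 - κ) := Real.rpow_le_rpow hn0.le hnN (by linarith)
    calc min 1 (16 * δ * n ^ (-κ)) * (1 + 2 * δ * n) ^ (q + 1)
        ≤ (16 * δ * n ^ (-κ)) * (16 * (δ ^ (q + 1) * n ^ (q + 1))) := by
          refine mul_le_mul (min_le_right _ _) h1 (by positivity) (by positivity)
      _ = 256 * (δ ^ (q + 2) * n ^ (q + 1 - κ)) := by
          have h5 : δ ^ (q + 2) = δ ^ (q + 1) * δ := by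
            rw [← Real.rpow_add_one hδ0.ne']; congr 1; ring
          have h6 : n ^ (q + 1 - κ) = n ^ (q + 1) * n ^ (-κ) := by
            rw [← Real.rpow_add hn0]; congr 1
          rw [h5, h6]; ring
      _ ≤ 256 * ((8 * N ^ (-((1 - κ) / 3) * (q + 2))) * N ^ (q + 1 - κ)) := by gcongr
      _ = 2048 * N ^ (q + (1 - κ) * (1 - q) / 3) := by
          rw [mul_assoc, ← Real.rpow_add hN0]
          have : -((1 - κ) / 3) * (q + 2) + (q + 1 - κ) = q + (1 - κ) * (1 - q) / 3 := by ring
          rw [this]; ring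

lemma lintegral_expSum_comp_le_of_separated {k : ℕ} (hk : 2 ≤ k) {N : ℕ} (hN : 0 < N) (a : ℤ → ℂ)
    {A : ℤ → Finset ℤ} (hA : ∀ t, A t ⊆ Finset.Icc (-(N : ℤ)) N) {b : ℝ → ℤ}
    (hbm : Measurable b) (hba : AntitoneOn b (Set.Ioo 0 1)) (T : Finset ℤ)
    (hT : ∀ x ∈ Set.Ioo (0 : ℝ) 1, b x ∉ T → A (b x) = ∅) {p B σ : ℝ} (hp : 2 ≤ p)
    (hσ : 0 < σ) (hσ1 : σ ≤ 1) (hB0 : 0 ≤ B) (hB : ∀ t, ((A t).card : ℝ) ≤ B)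
    (hsep : ∀ x ∈ Set.Ioo (0 : ℝ) 1, ∀ n ∈ A (b x), ∀ m ∈ A (b x),
      σ ≤ |1 - k * ((n : ℝ) + m) * x ^ (k - 1)|) :
    ∫⁻ x in Set.Ioo 0 1, ‖expSum k a (A (b x)) x‖ₑ ^ p
      ≤ ENNReal.ofReal ((B * ∑ n ∈ Finset.Icc (-(N : ℤ)) N, ‖a n‖ ^ 2) ^ ((p - 2) / 2)
        * (5 * (1 + Real.log N) / σ) * ∑ t ∈ T, ∑ n ∈ A t, ‖a n‖ ^ 2) := by
  have hL : 0 ≤ Real.log N := Real.log_nonneg (by exact_mod_cast hN)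
  refine lintegral_expSum_comp_le k a A hbm T (by linarith) (by positivity) hT fun t _ => ?_
  refine lintegral_expSum_le_of_separated hk hN a (hA t) (ordConnected_inter_preimage hba t)
    Set.inter_subset_left hp hσ hσ1 (hB t) ?_ ?_
  · exact Finset.sum_le_sum_of_subset_of_nonneg (hA t) fun _ _ _ => by positivity
  · rintro n hn m hm x ⟨hx, hxt⟩
    have hxt' : b x = t := hxt
    subst hxt'
    exact hsep x hx n hn m hm

/-- Frequencies at distance about `2⁻ʲ` from the critical frequency, in logarithmic scale. -/
lemma lintegral_expSum_logFiber_le {k : ℕ} (hk : 2 ≤ k) {N : ℕ} (hN : 0 < N) (a : ℤ → ℂ)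
    {p κ : ℝ} (hp : 2 ≤ p) (hp4 : p ≤ 4) (hκ : 0 ≤ κ) {j : ℕ}
    (hj : (2 : ℝ) ^ j ≤ (N : ℝ) ^ ((1 - κ) / 3)) {A : ℤ → Finset ℤ} {d : ℤ} (hd : 2 ≤ |d|)
    (hA : ∀ t, A t ⊆ logFiber N j (t + d)) :
    ∫⁻ x in Set.Ioo 0 1, ‖expSum k a (A (dyadicIndex j (logCrit k x))) x‖ₑ ^ p
      ≤ ENNReal.ofReal (3000 * (1 + Real.log N) ^ 2
        * (N : ℝ) ^ ((p - 2) / 2 + (1 - κ) * (1 - (p - 2) / 2) / 3)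
        * (∑ n ∈ Finset.Icc (-(N : ℤ)) N, ‖a n‖ ^ 2) ^ ((p - 2) / 2 + 1)) := by
  have hN1 : (1 : ℝ) ≤ N := by exact_mod_cast hN
  have hδ : (0 : ℝ) < (1 / 2) ^ j := by positivity
  have hδ1 : ((1 : ℝ) / 2) ^ j ≤ 1 := pow_le_one₀ (by norm_num) (by norm_num)
  have hδi : (((1 : ℝ) / 2) ^ j)⁻¹ = 2 ^ j := by rw [← inv_pow]; norm_num
  have h2N : (2 : ℝ) ^ j ≤ N := by
    refine hj.trans ?_
    calc (N : ℝ) ^ ((1 - κ) / 3) ≤ (N : ℝ) ^ (1 : ℝ) :=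
          Real.rpow_le_rpow_of_exponent_le hN1 (by linarith)
      _ = N := Real.rpow_one _
  have hδN : 1 ≤ ((1 : ℝ) / 2) ^ j * N := by
    rw [← hδi] at h2N
    rwa [inv_le_iff_one_le_mul₀' hδ] at h2N
  have hL : 0 ≤ Real.log N := Real.log_nonneg hN1
  set W := ∑ n ∈ Finset.Icc (-(N : ℤ)) N, ‖a n‖ ^ 2 with hW
  have hW0 : 0 ≤ W := by positivity
  have hpos : ∀ t, ∀ n ∈ A t, (1 : ℝ) ≤ n ∧ (n : ℝ) ≤ N ∧
      dyadicIndex j (Real.log n) = t + d := fun t n hn => by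
    have h := Finset.mem_filter.1 (hA t hn)
    have h1 := Finset.mem_Icc.1 h.1
    exact ⟨by exact_mod_cast h1.1, by exact_mod_cast h1.2, h.2⟩
  refine (lintegral_expSum_comp_le_of_separated hk hN a
    (fun t => (hA t).trans (logFiber_subset _ _ _))
    ((measurable_dyadicIndex j).comp (measurable_logCrit k))
    ((dyadicIndex_mono j).comp_antitoneOn (antitoneOn_logCrit hk))
    ((Finset.Icc (1 : ℤ) N).image (fun n : ℤ => dyadicIndex j (Real.log n) - d))
    (fun x _ hx => eq_empty_of_notMem_image hA hx) (B := 3 * (1 / 2) ^ j * N)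
    (σ := (1 / 2) ^ j / 2) hp (by positivity) (by linarith) (by positivity) ?_ ?_).trans ?_
  · intro t
    rcases (A t).eq_empty_or_nonempty with h | ⟨n, hn⟩
    · rw [h]; simp
    · have h1 : ((A t).card : ℝ) ≤ (logFiber N j (t + d)).card := by
        exact_mod_cast Finset.card_le_card (hA t)
      have h2 := card_logFiber_le (hA t hn)
      have h3 := (hpos t n hn).2.1
      nlinarith
  · intro x hx n hn m hm
    have h1 := hpos _ n hn
    have h2 := hpos _ m hm
    refine half_le_abs_of_log_separated hk hx.1 (by linarith) (by linarith) hδ hδ1 ?_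
    rcases le_abs.1 hd with h | h
    · left
      exact ⟨add_le_of_dyadicIndex_add_two_le (by simp only [Function.comp] at h1; omega),
        add_le_of_dyadicIndex_add_two_le (by simp only [Function.comp] at h2; omega)⟩
    · right
      exact ⟨add_le_of_dyadicIndex_add_two_le (by simp only [Function.comp] at h1; omega),
        add_le_of_dyadicIndex_add_two_le (by simp only [Function.comp] at h2; omega)⟩
  · refine ENNReal.ofReal_le_ofReal ?_
    have h1 := sum_logFiber_le a N j d hA
    have h2 := rpow_div_le_of_scale (κ := κ) (q := (p - 2) / 2) hN1 (by linarith) hδ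
      (by rw [hδi]; exact hj)
    rw [Real.rpow_add_one' hW0 (by linarith), Real.mul_rpow (by positivity) hW0]
    set δ := ((1 : ℝ) / 2) ^ j
    set q := (p - 2) / 2
    calc (3 * δ * N) ^ q * W ^ q * (5 * (1 + Real.log N) / (δ / 2)) * _
        ≤ (3 * δ * N) ^ q * W ^ q * (5 * (1 + Real.log N) / (δ / 2)) * W :=
          mul_le_mul_of_nonneg_left h1 (by positivity)
      _ = ((3 * δ * N) ^ q / δ) * (10 * (1 + Real.log N)) * (W ^ q * W) := by
          field_simp; ring
      _ ≤ (3 * (N : ℝ) ^ (q + (1 - κ) * (1 - q) / 3)) * (1000 * (1 + Real.log N) ^ 2)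
            * (W ^ q * W) := by
          have h3 : 10 * (1 + Real.log N) ≤ 1000 * (1 + Real.log N) ^ 2 := by nlinarith
          exact mul_le_mul_of_nonneg_right (mul_le_mul h2 h3 (by positivity) (by positivity))
            (by positivity)
      _ = _ := by ring

/-- Frequencies near the critical frequency at the finest scale. -/
lemma lintegral_expSum_logFiber_near_le {k : ℕ} (hk : 2 ≤ k) {N : ℕ} (hN : 0 < N) (a : ℤ → ℂ)
    {p : ℝ} (hp : 2 ≤ p) (hp4 : p ≤ 4) {j : ℕ}
    (hj : (N : ℝ) ^ ((1 - 1 / ((k : ℝ) - 1)) / 3) ≤ 2 * 2 ^ j) {d : ℤ} (hd : |d| ≤ 1) :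
    ∫⁻ x in Set.Ioo 0 1, ‖expSum k a (logFiber N j (dyadicIndex j (logCrit k x) + d)) x‖ₑ ^ p
      ≤ ENNReal.ofReal (3000 * (1 + Real.log N) ^ 2
        * (N : ℝ) ^ ((p - 2) / 2 + (1 - 1 / ((k : ℝ) - 1)) * (1 - (p - 2) / 2) / 3)
        * (∑ n ∈ Finset.Icc (-(N : ℤ)) N, ‖a n‖ ^ 2) ^ ((p - 2) / 2 + 1)) := by
  have hN1 : (1 : ℝ) ≤ N := by exact_mod_cast hN
  have hδ : (0 : ℝ) < (1 / 2) ^ j := by positivity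
  have hδi : ((1 : ℝ) / 2) ^ j * 2 ^ j = 1 := by rw [← mul_pow]; norm_num
  have hL : 0 ≤ Real.log N := Real.log_nonneg hN1
  set κ := 1 / ((k : ℝ) - 1) with hκ
  have hκ1 : κ ≤ 1 := by
    have : (2 : ℝ) ≤ k := by exact_mod_cast hk
    rw [hκ, div_le_one (by linarith)]; linarith
  set W := ∑ n ∈ Finset.Icc (-(N : ℤ)) N, ‖a n‖ ^ 2 with hW
  have hW0 : 0 ≤ W := by positivity
  set q := (p - 2) / 2 with hq
  set E := q + (1 - κ) * (1 - q) / 3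
  have hA : ∀ t, logFiber N j (t + d) ⊆ logFiber N j (t + d) := fun t => subset_rfl
  refine (lintegral_expSum_comp_le k a (fun t => logFiber N j (t + d))
    ((measurable_dyadicIndex j).comp (measurable_logCrit k))
    ((Finset.Icc (1 : ℤ) N).image (fun n : ℤ => dyadicIndex j (Real.log n) - d))
    (Q := 2048 * (N : ℝ) ^ E * W ^ q) (by linarith) (by positivity)
    (fun x _ hx => eq_empty_of_notMem_image hA hx) ?_).trans ?_
  · intro t _
    rcases (logFiber N j (t + d)).eq_empty_or_nonempty with h | ⟨n, hn⟩
    · rw [h]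
      simp [expSum, show 0 < p by linarith]
    · have h := Finset.mem_filter.1 hn
      have h1 := Finset.mem_Icc.1 h.1
      have hnd : |dyadicIndex j (Real.log n) - t| ≤ 1 := by rw [h.2]; simpa using hd
      have hV := ediam_le_of_logCrit hk h1.1 hnd
      have hV1 : volume (Set.Ioo (0 : ℝ) 1 ∩ (fun x => dyadicIndex j (logCrit k x)) ⁻¹' {t})
          ≤ ENNReal.ofReal 1 := by
        refine (measure_mono Set.inter_subset_left).trans ?_
        simp
      have hVm : volume (Set.Ioo (0 : ℝ) 1 ∩ (fun x => dyadicIndex j (logCrit k x)) ⁻¹' {t})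
          ≤ ENNReal.ofReal (min 1 (16 * (1 / 2) ^ j * (n : ℝ) ^ (-κ))) := by
        rcases min_choice (1 : ℝ) (16 * (1 / 2) ^ j * (n : ℝ) ^ (-κ)) with h | h <;> rw [h]
        · exact hV1
        · exact hV
      have hn1 : (1 : ℝ) ≤ n := by exact_mod_cast h1.1
      refine (lintegral_expSum_le_of_volume_le k a _ hp hVm (card_logFiber_le hn)
        (W := W) ?_).trans ?_
      · exact Finset.sum_le_sum_of_subset_of_nonneg (logFiber_subset _ _ _)
          fun _ _ _ => by positivity
      · refine ENNReal.ofReal_le_ofReal (mul_le_mul_of_nonneg_right ?_ (by positivity))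
        have h2 := rpow_mul_min_le_of_scale (κ := κ) (q := q) hn1
          (show (n : ℝ) ≤ N by exact_mod_cast h1.2) (by linarith) (by linarith) hκ1 hδ
          (by nlinarith)
        rw [← hq, Real.mul_rpow (by positivity) hW0]
        calc _ = ((1 + 2 * (1 / 2) ^ j * (n : ℝ)) ^ q * (min 1 (16 * (1 / 2) ^ j * (n : ℝ) ^ (-κ))
              * (1 + 2 * (1 / 2) ^ j * n))) * W ^ q := by ring
          _ ≤ _ := mul_le_mul_of_nonneg_right h2 (by positivity)
  · refine ENNReal.ofReal_le_ofReal ?_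
    have h1 := sum_logFiber_le a N j d hA
    rw [Real.rpow_add_one' hW0 (by linarith)]
    calc 2048 * (N : ℝ) ^ E * W ^ q * _ ≤ 2048 * (N : ℝ) ^ E * W ^ q * W :=
          mul_le_mul_of_nonneg_left h1 (by positivity)
      _ = 2048 * (N : ℝ) ^ E * (W ^ q * W) := by ring
      _ ≤ (3000 * (1 + Real.log N) ^ 2) * (N : ℝ) ^ E * (W ^ q * W) := by
          gcongr
          nlinarith
      _ = _ := by ring

lemma lintegral_expSum_comp_le_of_half_separated {k : ℕ} (hk : 2 ≤ k) {N : ℕ} (hN : 0 < N)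
    (a : ℤ → ℂ) {A : ℤ → Finset ℤ} (hA : ∀ t, A t ⊆ Finset.Icc (-(N : ℤ)) N) {b : ℝ → ℤ}
    (hbm : Measurable b) (hba : AntitoneOn b (Set.Ioo 0 1)) (T : Finset ℤ)
    (hT : ∀ x ∈ Set.Ioo (0 : ℝ) 1, b x ∉ T → A (b x) = ∅)
    (hTc : (T.card : ℝ) ≤ 5 * (1 + Real.log N)) {p κ : ℝ} (hp : 2 ≤ p) (hp4 : p ≤ 4)
    (hκ1 : κ ≤ 1)
    (hsep : ∀ x ∈ Set.Ioo (0 : ℝ) 1, ∀ n ∈ A (b x), ∀ m ∈ A (b x),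
      1 / 2 ≤ |1 - k * ((n : ℝ) + m) * x ^ (k - 1)|) :
    ∫⁻ x in Set.Ioo 0 1, ‖expSum k a (A (b x)) x‖ₑ ^ p
      ≤ ENNReal.ofReal (3000 * (1 + Real.log N) ^ 2
        * (N : ℝ) ^ ((p - 2) / 2 + (1 - κ) * (1 - (p - 2) / 2) / 3)
        * (∑ n ∈ Finset.Icc (-(N : ℤ)) N, ‖a n‖ ^ 2) ^ ((p - 2) / 2 + 1)) := by
  have hN1 : (1 : ℝ) ≤ N := by exact_mod_cast hN
  have hL : 0 ≤ Real.log N := Real.log_nonneg hN1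
  refine (lintegral_expSum_comp_le_of_separated hk hN a hA hbm hba T hT (B := 3 * N)
    (σ := 1 / 2) hp (by norm_num) (by norm_num) (by positivity) ?_ hsep).trans ?_
  · intro t
    have h := Finset.card_le_card (hA t)
    rw [Int.card_Icc] at h
    have h1 : (A t).card ≤ 3 * N := by omega
    exact_mod_cast h1
  · refine ENNReal.ofReal_le_ofReal ?_
    set W := ∑ n ∈ Finset.Icc (-(N : ℤ)) N, ‖a n‖ ^ 2
    have hW0 : 0 ≤ W := by positivity
    have h1 : ∑ t ∈ T, ∑ n ∈ A t, ‖a n‖ ^ 2 ≤ 5 * (1 + Real.log N) * W := by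
      calc ∑ t ∈ T, ∑ n ∈ A t, ‖a n‖ ^ 2 ≤ ∑ t ∈ T, W := Finset.sum_le_sum fun t _ =>
            Finset.sum_le_sum_of_subset_of_nonneg (hA t) fun _ _ _ => by positivity
        _ = T.card * W := by rw [Finset.sum_const, nsmul_eq_mul]
        _ ≤ _ := mul_le_mul_of_nonneg_right hTc hW0
    set q := (p - 2) / 2 with hq
    have hq0 : 0 ≤ q := by linarith
    have hq1 : q ≤ 1 := by linarith
    rw [Real.rpow_add_one' hW0 (by linarith), Real.mul_rpow (by positivity) hW0,
      Real.mul_rpow (by positivity) (by positivity)]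
    have h2 : (3 : ℝ) ^ q ≤ 3 := by
      calc (3 : ℝ) ^ q ≤ 3 ^ (1 : ℝ) := Real.rpow_le_rpow_of_exponent_le (by norm_num) hq1
        _ = 3 := Real.rpow_one _
    have h3 : (N : ℝ) ^ q ≤ (N : ℝ) ^ (q + (1 - κ) * (1 - q) / 3) := by
      refine Real.rpow_le_rpow_of_exponent_le hN1 ?_
      have : 0 ≤ (1 - κ) * (1 - q) := mul_nonneg (by linarith) (by linarith)
      linarith
    calc 3 ^ q * (N : ℝ) ^ q * W ^ q * (5 * (1 + Real.log N) / (1 / 2)) * _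
        ≤ 3 ^ q * (N : ℝ) ^ q * W ^ q * (5 * (1 + Real.log N) / (1 / 2))
          * (5 * (1 + Real.log N) * W) := mul_le_mul_of_nonneg_left h1 (by positivity)
      _ = (3 ^ q * (50 * (1 + Real.log N) ^ 2)) * (N : ℝ) ^ q * (W ^ q * W) := by ring
      _ ≤ (3 * (1000 * (1 + Real.log N) ^ 2)) * (N : ℝ) ^ (q + (1 - κ) * (1 - q) / 3)
          * (W ^ q * W) := by
        gcongr
        norm_num
      _ = _ := by ring

/-- Frequencies whose logarithm is within about `2⁻ʲ` of the `t`-th dyadic interval. -/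
noncomputable def logNear (N j : ℕ) (t : ℤ) : Finset ℤ :=
  (Finset.Icc (1 : ℤ) N).filter fun n => |dyadicIndex j (Real.log n) - t| ≤ 1

noncomputable def logBelow (N : ℕ) (t : ℤ) : Finset ℤ :=
  (Finset.Icc (1 : ℤ) N).filter fun n => dyadicIndex 0 (Real.log n) + 2 ≤ t

noncomputable def logAbove (N : ℕ) (t : ℤ) : Finset ℤ :=
  (Finset.Icc (1 : ℤ) N).filter fun n => t + 2 ≤ dyadicIndex 0 (Real.log n)

/-- Truncation of the dyadic index of the critical frequency to the relevant range. -/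
noncomputable def clippedIndex (k N : ℕ) (x : ℝ) : ℤ :=
  max (-2) (min (dyadicIndex 0 (logCrit k x)) (dyadicIndex 0 (Real.log N) + 2))

lemma measurable_clippedIndex (k N : ℕ) : Measurable (clippedIndex k N) :=
  measurable_const.max
    (((measurable_dyadicIndex 0).comp (measurable_logCrit k)).min measurable_const)

lemma antitoneOn_clippedIndex {k : ℕ} (hk : 2 ≤ k) (N : ℕ) :
    AntitoneOn (clippedIndex k N) (Set.Ioo 0 1) := by
  intro x hx y hy hxy
  have h := (dyadicIndex_mono 0) (antitoneOn_logCrit hk hx hy hxy)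
  unfold clippedIndex
  omega

lemma dyadicIndex_zero_log_mem {N : ℕ} {n : ℤ} (hn : n ∈ Finset.Icc (1 : ℤ) N) :
    0 ≤ dyadicIndex 0 (Real.log n) ∧ dyadicIndex 0 (Real.log n) ≤ dyadicIndex 0 (Real.log N) := by
  obtain ⟨h1, h2⟩ := Finset.mem_Icc.1 hn
  have h1' : (1 : ℝ) ≤ n := by exact_mod_cast h1
  have h2' : (n : ℝ) ≤ N := by exact_mod_cast h2
  refine ⟨Int.floor_nonneg.2 ?_, dyadicIndex_mono 0 (Real.log_le_log (by linarith) h2')⟩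
  have := Real.log_nonneg h1'
  positivity

lemma clippedIndex_mem (k N : ℕ) (hN : 0 < N) (x : ℝ) :
    clippedIndex k N x ∈ Finset.Icc (-2) (dyadicIndex 0 (Real.log N) + 2) := by
  have h := (dyadicIndex_zero_log_mem (N := N) (n := 1) (by simp; omega))
  have h2 := h.1.trans h.2
  rw [Finset.mem_Icc]
  unfold clippedIndex
  omega

lemma card_clippedIndex_le {N : ℕ} (hN : 0 < N) :
    ((Finset.Icc (-2) (dyadicIndex 0 (Real.log N) + 2)).card : ℝ) ≤ 5 * (1 + Real.log N) := by
  have h := (dyadicIndex_zero_log_mem (N := N) (n := 1) (by simp; omega))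
  have h2 := h.1.trans h.2
  rw [Int.card_Icc]
  have h3 : (((dyadicIndex 0 (Real.log N) + 2 + 1 - -2).toNat : ℤ) : ℝ)
      = dyadicIndex 0 (Real.log N) + 5 := by
    rw [Int.toNat_of_nonneg (by omega)]; push_cast; ring
  have h4 : ((dyadicIndex 0 (Real.log N) : ℤ) : ℝ) ≤ Real.log N := by
    have := Int.floor_le ((2 : ℝ) ^ 0 * Real.log N)
    rw [pow_zero, one_mul] at this
    rw [dyadicIndex, pow_zero, one_mul]
    exact this
  have h5 : 0 ≤ Real.log N := Real.log_nonneg (by exact_mod_cast hN)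
  rw [Int.cast_natCast] at h3
  linarith

lemma lintegral_expSum_nonpos_le {k : ℕ} (hk : 2 ≤ k) {N : ℕ} (hN : 0 < N) (a : ℤ → ℂ)
    {p κ : ℝ} (hp : 2 ≤ p) (hp4 : p ≤ 4) (hκ1 : κ ≤ 1) :
    ∫⁻ x in Set.Ioo 0 1, ‖expSum k a (Finset.Icc (-(N : ℤ)) 0) x‖ₑ ^ p
      ≤ ENNReal.ofReal (3000 * (1 + Real.log N) ^ 2
        * (N : ℝ) ^ ((p - 2) / 2 + (1 - κ) * (1 - (p - 2) / 2) / 3)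
        * (∑ n ∈ Finset.Icc (-(N : ℤ)) N, ‖a n‖ ^ 2) ^ ((p - 2) / 2 + 1)) := by
  have hL : 0 ≤ Real.log N := Real.log_nonneg (by exact_mod_cast hN)
  refine lintegral_expSum_comp_le_of_half_separated hk hN a
    (A := fun _ => Finset.Icc (-(N : ℤ)) 0) (b := fun _ => 0)
    (fun _ => Finset.Icc_subset_Icc le_rfl (by omega)) measurable_const
    (fun _ _ _ _ _ => le_rfl) {0} (fun _ _ h => absurd (Finset.mem_singleton_self 0) h)
    (by simp; linarith) hp hp4 hκ1 ?_
  intro x hx n hn m hm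
  have hn0 : (n : ℝ) ≤ 0 := by exact_mod_cast (Finset.mem_Icc.1 hn).2
  have hm0 : (m : ℝ) ≤ 0 := by exact_mod_cast (Finset.mem_Icc.1 hm).2
  have h : k * ((n : ℝ) + m) * x ^ (k - 1) ≤ 0 :=
    mul_nonpos_of_nonpos_of_nonneg (mul_nonpos_of_nonneg_of_nonpos (by positivity) (by linarith))
      (pow_nonneg hx.1.le _)
  rw [abs_of_nonneg (by linarith)]
  linarith

lemma lintegral_expSum_logBelow_le {k : ℕ} (hk : 2 ≤ k) {N : ℕ} (hN : 0 < N) (a : ℤ → ℂ)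
    {p κ : ℝ} (hp : 2 ≤ p) (hp4 : p ≤ 4) (hκ1 : κ ≤ 1) :
    ∫⁻ x in Set.Ioo 0 1, ‖expSum k a (logBelow N (clippedIndex k N x)) x‖ₑ ^ p
      ≤ ENNReal.ofReal (3000 * (1 + Real.log N) ^ 2
        * (N : ℝ) ^ ((p - 2) / 2 + (1 - κ) * (1 - (p - 2) / 2) / 3)
        * (∑ n ∈ Finset.Icc (-(N : ℤ)) N, ‖a n‖ ^ 2) ^ ((p - 2) / 2 + 1)) := by
  refine lintegral_expSum_comp_le_of_half_separated hk hN a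
    (A := logBelow N) (b := clippedIndex k N) (fun _ => (Finset.filter_subset _ _).trans
      (Finset.Icc_subset_Icc (by omega) le_rfl))
    (measurable_clippedIndex k N) (antitoneOn_clippedIndex hk N)
    (Finset.Icc (-2) (dyadicIndex 0 (Real.log N) + 2))
    (fun x _ h => absurd (clippedIndex_mem k N hN x) h) (card_clippedIndex_le hN) hp hp4 hκ1 ?_
  intro x hx n hn m hm
  have key : ∀ n ∈ logBelow N (clippedIndex k N x), (0 : ℝ) < n ∧
      Real.log n + 1 ≤ logCrit k x := fun n hn => by
    obtain ⟨h1, h2⟩ := Finset.mem_filter.1 hn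
    have h3 := dyadicIndex_zero_log_mem h1
    refine ⟨by exact_mod_cast (Finset.mem_Icc.1 h1).1, ?_⟩
    have h4 := add_le_of_dyadicIndex_add_two_le (j := 0) (s := Real.log n) (t := logCrit k x)
      (by unfold clippedIndex at h2; omega)
    simpa using h4
  exact half_le_abs_of_log_separated hk hx.1 (key n hn).1 (key m hm).1 one_pos le_rfl
    (Or.inr ⟨(key n hn).2, (key m hm).2⟩)

lemma lintegral_expSum_logAbove_le {k : ℕ} (hk : 2 ≤ k) {N : ℕ} (hN : 0 < N) (a : ℤ → ℂ)
    {p κ : ℝ} (hp : 2 ≤ p) (hp4 : p ≤ 4) (hκ1 : κ ≤ 1) :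
    ∫⁻ x in Set.Ioo 0 1, ‖expSum k a (logAbove N (clippedIndex k N x)) x‖ₑ ^ p
      ≤ ENNReal.ofReal (3000 * (1 + Real.log N) ^ 2
        * (N : ℝ) ^ ((p - 2) / 2 + (1 - κ) * (1 - (p - 2) / 2) / 3)
        * (∑ n ∈ Finset.Icc (-(N : ℤ)) N, ‖a n‖ ^ 2) ^ ((p - 2) / 2 + 1)) := by
  refine lintegral_expSum_comp_le_of_half_separated hk hN a
    (A := logAbove N) (b := clippedIndex k N) (fun _ => (Finset.filter_subset _ _).trans
      (Finset.Icc_subset_Icc (by omega) le_rfl))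
    (measurable_clippedIndex k N) (antitoneOn_clippedIndex hk N)
    (Finset.Icc (-2) (dyadicIndex 0 (Real.log N) + 2))
    (fun x _ h => absurd (clippedIndex_mem k N hN x) h) (card_clippedIndex_le hN) hp hp4 hκ1 ?_
  intro x hx n hn m hm
  have key : ∀ n ∈ logAbove N (clippedIndex k N x), (0 : ℝ) < n ∧
      logCrit k x + 1 ≤ Real.log n := fun n hn => by
    obtain ⟨h1, h2⟩ := Finset.mem_filter.1 hn
    have h3 := dyadicIndex_zero_log_mem h1
    refine ⟨by exact_mod_cast (Finset.mem_Icc.1 h1).1, ?_⟩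
    have h4 := add_le_of_dyadicIndex_add_two_le (j := 0) (s := logCrit k x) (t := Real.log n)
      (by unfold clippedIndex at h2; omega)
    simpa using h4
  exact half_le_abs_of_log_separated hk hx.1 (key n hn).1 (key m hm).1 one_pos le_rfl
    (Or.inl ⟨(key n hn).2, (key m hm).2⟩)

lemma expSum_eq_add_logNear_zero (k : ℕ) (a : ℤ → ℂ) (N : ℕ) (x : ℝ) :
    expSum k a (Finset.Icc (-(N : ℤ)) N) x
      = expSum k a (logNear N 0 (dyadicIndex 0 (logCrit k x))) x
        + expSum k a (Finset.Icc (-(N : ℤ)) 0) x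
        + expSum k a (logBelow N (clippedIndex k N x)) x
        + expSum k a (logAbove N (clippedIndex k N x)) x := by
  have h1 : Finset.Icc (-(N : ℤ)) N
      = Finset.Icc (-(N : ℤ)) 0 ∪ Finset.Icc (1 : ℤ) N := by
    ext n; simp only [Finset.mem_union, Finset.mem_Icc]; omega
  have h2 : Disjoint (Finset.Icc (-(N : ℤ)) 0) (Finset.Icc (1 : ℤ) N) := by
    rw [Finset.disjoint_left]
    intro n hn hn'
    have := (Finset.mem_Icc.1 hn).2
    have := (Finset.mem_Icc.1 hn').1
    omega
  unfold expSum
  rw [h1, Finset.sum_union h2]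
  suffices h : ∑ n ∈ Finset.Icc (1 : ℤ) N, a n * e ((n : ℝ) * x - (n : ℝ) ^ 2 * x ^ k)
      = ∑ n ∈ logNear N 0 (dyadicIndex 0 (logCrit k x)),
          a n * e ((n : ℝ) * x - (n : ℝ) ^ 2 * x ^ k)
        + ∑ n ∈ logBelow N (clippedIndex k N x), a n * e ((n : ℝ) * x - (n : ℝ) ^ 2 * x ^ k)
        + ∑ n ∈ logAbove N (clippedIndex k N x), a n * e ((n : ℝ) * x - (n : ℝ) ^ 2 * x ^ k) by
    rw [h]; ring
  unfold logNear logBelow logAbove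
  rw [Finset.sum_filter, Finset.sum_filter, Finset.sum_filter, ← Finset.sum_add_distrib,
    ← Finset.sum_add_distrib]
  refine Finset.sum_congr rfl fun n hn => ?_
  have h3 := dyadicIndex_zero_log_mem hn
  unfold clippedIndex
  simp only [abs_le]
  split_ifs <;> first | omega | simp

lemma expSum_logNear_eq (k : ℕ) (a : ℤ → ℂ) (N j : ℕ) (x : ℝ) :
    expSum k a (logNear N j (dyadicIndex j (logCrit k x))) x
      = expSum k a (logNear N (j + 1) (dyadicIndex (j + 1) (logCrit k x))) x
        + expSum k a (logFiber N (j + 1) (dyadicIndex (j + 1) (logCrit k x) + 2)) x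
        + expSum k a (logFiber N (j + 1) (dyadicIndex (j + 1) (logCrit k x) + -2)) x
        + expSum k a (if dyadicIndex (j + 1) (logCrit k x) % 2 = 0 then
            logFiber N (j + 1) (dyadicIndex (j + 1) (logCrit k x) + 3) else ∅) x
        + expSum k a (if dyadicIndex (j + 1) (logCrit k x) % 2 = 0 then ∅ else
            logFiber N (j + 1) (dyadicIndex (j + 1) (logCrit k x) + -3)) x := by
  rw [dyadicIndex_eq_succ_div]
  generalize dyadicIndex (j + 1) (logCrit k x) = t
  have h1 : (if t % 2 = 0 then logFiber N (j + 1) (t + 3) else ∅)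
      = (Finset.Icc (1 : ℤ) N).filter
        (fun n : ℤ => t % 2 = 0 ∧ dyadicIndex (j + 1) (Real.log n) = t + 3) := by
    split_ifs with h <;> simp [h, logFiber]
  have h2 : (if t % 2 = 0 then ∅ else logFiber N (j + 1) (t + -3))
      = (Finset.Icc (1 : ℤ) N).filter
        (fun n : ℤ => t % 2 ≠ 0 ∧ dyadicIndex (j + 1) (Real.log n) = t + -3) := by
    split_ifs with h <;> simp [h, logFiber]
  rw [h1, h2]
  unfold expSum logNear logFiber
  simp only [Finset.sum_filter, ← Finset.sum_add_distrib]
  refine Finset.sum_congr rfl fun n hn => ?_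
  rw [dyadicIndex_eq_succ_div]
  generalize dyadicIndex (j + 1) (Real.log n) = u
  simp only [abs_le]
  split_ifs <;> first | omega | simp

lemma expSum_logNear_eq_add (k : ℕ) (a : ℤ → ℂ) (N j : ℕ) (x : ℝ) :
    expSum k a (logNear N j (dyadicIndex j (logCrit k x))) x
      = expSum k a (logFiber N j (dyadicIndex j (logCrit k x) + 0)) x
        + expSum k a (logFiber N j (dyadicIndex j (logCrit k x) + 1)) x
        + expSum k a (logFiber N j (dyadicIndex j (logCrit k x) + -1)) x := by
  unfold expSum logNear logFiber
  simp only [Finset.sum_filter, ← Finset.sum_add_distrib]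
  refine Finset.sum_congr rfl fun n hn => ?_
  simp only [abs_le]
  split_ifs <;> first | omega | simp

lemma eLpNorm_le_of_lintegral_le {f : ℝ → ℂ} {p : ℝ} (hp : 0 < p) {μ : Measure ℝ} {D : ENNReal}
    (h : ∫⁻ x, ‖f x‖ₑ ^ p ∂μ ≤ D) : eLpNorm f (ENNReal.ofReal p) μ ≤ D ^ (1 / p) := by
  rw [eLpNorm_eq_lintegral_rpow_enorm_toReal (by simpa using hp) ENNReal.ofReal_ne_top,
    ENNReal.toReal_ofReal hp.le]
  exact ENNReal.rpow_le_rpow h (by positivity)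

lemma eLpNorm_logNear_zero_le {k : ℕ} {N : ℕ} (a : ℤ → ℂ) {p s : ℝ} (hp : 2 ≤ p)
    {X : ENNReal}
    (hX : ∀ (j : ℕ) (A : ℤ → Finset ℤ) (d : ℤ), (2 : ℝ) ^ j ≤ s → 2 ≤ |d| →
      (∀ t, A t ⊆ logFiber N j (t + d)) →
      eLpNorm (fun x => expSum k a (A (dyadicIndex j (logCrit k x))) x) (ENNReal.ofReal p)
        (volume.restrict (Set.Ioo 0 1)) ≤ X) (j : ℕ) (hj : (2 : ℝ) ^ j ≤ s) :
    eLpNorm (fun x => expSum k a (logNear N 0 (dyadicIndex 0 (logCrit k x))) x)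
        (ENNReal.ofReal p) (volume.restrict (Set.Ioo 0 1))
      ≤ eLpNorm (fun x => expSum k a (logNear N j (dyadicIndex j (logCrit k x))) x)
        (ENNReal.ofReal p) (volume.restrict (Set.Ioo 0 1)) + (4 * j : ℕ) * X := by
  have hp1 : 1 ≤ ENNReal.ofReal p := by
    rw [← ENNReal.ofReal_one]; exact ENNReal.ofReal_le_ofReal (by linarith)
  induction j with
  | zero => simp
  | succ j ih =>
    refine (ih (le_trans (by gcongr <;> norm_num) hj)).trans ?_
    have hm : ∀ A : ℤ → Finset ℤ, AEStronglyMeasurable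
        (fun x => expSum k a (A (dyadicIndex (j + 1) (logCrit k x))) x)
        (volume.restrict (Set.Ioo 0 1)) := fun A =>
      (measurable_expSum_comp k a A
        ((measurable_dyadicIndex (j + 1)).comp (measurable_logCrit k))).aestronglyMeasurable
    have h0 := hm (logNear N (j + 1))
    have h1 := hm fun t => logFiber N (j + 1) (t + 2)
    have h2 := hm fun t => logFiber N (j + 1) (t + -2)
    have h3 := hm fun t => if t % 2 = 0 then logFiber N (j + 1) (t + 3) else ∅
    have h4 := hm fun t => if t % 2 = 0 then ∅ else logFiber N (j + 1) (t + -3)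
    have b1 := hX (j + 1) (fun t => logFiber N (j + 1) (t + 2)) 2 hj (by norm_num)
      fun t => subset_rfl
    have b2 := hX (j + 1) (fun t => logFiber N (j + 1) (t + -2)) (-2) hj (by norm_num)
      fun t => subset_rfl
    have b3 := hX (j + 1) (fun t => if t % 2 = 0 then logFiber N (j + 1) (t + 3) else ∅) 3 hj
      (by norm_num) fun t => by split_ifs <;> simp
    have b4 := hX (j + 1) (fun t => if t % 2 = 0 then ∅ else logFiber N (j + 1) (t + -3)) (-3) hj
      (by norm_num) fun t => by split_ifs <;> simp
    have heq : (fun x => expSum k a (logNear N j (dyadicIndex j (logCrit k x))) x) = _ :=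
      funext fun x => expSum_logNear_eq k a N j x
    rw [heq]
    have key := (eLpNorm_add_le (((h0.add h1).add h2).add h3) h4 hp1).trans <| add_le_add
      ((eLpNorm_add_le ((h0.add h1).add h2) h3 hp1).trans <| add_le_add
        ((eLpNorm_add_le (h0.add h1) h2 hp1).trans <| add_le_add
          ((eLpNorm_add_le h0 h1 hp1).trans <| add_le_add le_rfl b1) b2) b3) b4
    refine (add_le_add key le_rfl).trans (le_of_eq ?_)
    push_cast
    ring

lemma add_four_mul_le {N J : ℕ} (hJ : (2 : ℝ) ^ J ≤ N) :
    ((6 + 4 * J : ℕ) : ℝ) ≤ 8 * (1 + Real.log N) := by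
  have h := Real.log_le_log (by positivity) hJ
  rw [Real.log_pow] at h
  have h2 := Real.log_two_gt_d9
  have h3 : (0 : ℝ) ≤ J := by positivity
  push_cast
  nlinarith

lemma eLpNorm_expSum_half_le {k : ℕ} (hk : 2 ≤ k) {N : ℕ} (hN : 0 < N) (a : ℤ → ℂ)
    {p : ℝ} (hp : 2 ≤ p) (hp4 : p ≤ 4) :
    eLpNorm (expSum k a (Finset.Icc (-(N : ℤ)) N)) (ENNReal.ofReal p)
        (volume.restrict (Set.Ioo 0 1))
      ≤ ENNReal.ofReal (8 * (1 + Real.log N)) * ENNReal.ofReal (3000 * (1 + Real.log N) ^ 2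
        * (N : ℝ) ^ ((p - 2) / 2 + (1 - 1 / ((k : ℝ) - 1)) * (1 - (p - 2) / 2) / 3)
        * (∑ n ∈ Finset.Icc (-(N : ℤ)) N, ‖a n‖ ^ 2) ^ ((p - 2) / 2 + 1)) ^ (1 / p) := by
  have hp0 : 0 < p := by linarith
  have hp1 : 1 ≤ ENNReal.ofReal p := by
    rw [← ENNReal.ofReal_one]; exact ENNReal.ofReal_le_ofReal (by linarith)
  have hN1 : (1 : ℝ) ≤ N := by exact_mod_cast hN
  have hk2 : (2 : ℝ) ≤ k := by exact_mod_cast hk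
  have hκ0 : 0 ≤ 1 / ((k : ℝ) - 1) := div_nonneg zero_le_one (by linarith)
  have hκ1 : 1 / ((k : ℝ) - 1) ≤ 1 := by rw [div_le_one (by linarith)]; linarith
  set X := ENNReal.ofReal (3000 * (1 + Real.log N) ^ 2
        * (N : ℝ) ^ ((p - 2) / 2 + (1 - 1 / ((k : ℝ) - 1)) * (1 - (p - 2) / 2) / 3)
        * (∑ n ∈ Finset.Icc (-(N : ℤ)) N, ‖a n‖ ^ 2) ^ ((p - 2) / 2 + 1)) ^ (1 / p) with hX
  obtain ⟨J, hJ1, hJ2⟩ := exists_nat_pow_near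
    (Real.one_le_rpow hN1 (show 0 ≤ (1 - 1 / ((k : ℝ) - 1)) / 3 by linarith)) one_lt_two
  have hJN : (2 : ℝ) ^ J ≤ N := hJ1.trans <| by
    calc (N : ℝ) ^ ((1 - 1 / ((k : ℝ) - 1)) / 3) ≤ (N : ℝ) ^ (1 : ℝ) :=
          Real.rpow_le_rpow_of_exponent_le hN1 (by linarith)
      _ = N := Real.rpow_one _
  have hm : ∀ (A : ℤ → Finset ℤ) (j : ℕ), AEStronglyMeasurable
      (fun x => expSum k a (A (dyadicIndex j (logCrit k x))) x)
      (volume.restrict (Set.Ioo 0 1)) := fun A j =>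
    (measurable_expSum_comp k a A
      ((measurable_dyadicIndex j).comp (measurable_logCrit k))).aestronglyMeasurable
  have hmc : ∀ A : ℤ → Finset ℤ, AEStronglyMeasurable
      (fun x => expSum k a (A (clippedIndex k N x)) x) (volume.restrict (Set.Ioo 0 1)) := fun A =>
    (measurable_expSum_comp k a A (measurable_clippedIndex k N)).aestronglyMeasurable
  have hnear : ∀ d : ℤ, |d| ≤ 1 →
      eLpNorm (fun x => expSum k a (logFiber N J (dyadicIndex J (logCrit k x) + d)) x)
        (ENNReal.ofReal p) (volume.restrict (Set.Ioo 0 1)) ≤ X := fun d hd =>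
    eLpNorm_le_of_lintegral_le hp0 (lintegral_expSum_logFiber_near_le hk hN a hp hp4
      (by rw [pow_succ'] at hJ2; exact hJ2.le) hd)
  have hfine : eLpNorm (fun x => expSum k a (logNear N J (dyadicIndex J (logCrit k x))) x)
      (ENNReal.ofReal p) (volume.restrict (Set.Ioo 0 1)) ≤ X + X + X := by
    have heq : (fun x => expSum k a (logNear N J (dyadicIndex J (logCrit k x))) x) = _ :=
      funext fun x => expSum_logNear_eq_add k a N J x
    rw [heq]
    have h0 := hm (fun t => logFiber N J (t + 0)) J
    have h1 := hm (fun t => logFiber N J (t + 1)) J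
    have h2 := hm (fun t => logFiber N J (t + -1)) J
    exact (eLpNorm_add_le (h0.add h1) h2 hp1).trans <| add_le_add
      ((eLpNorm_add_le h0 h1 hp1).trans <| add_le_add (hnear 0 (by norm_num))
        (hnear 1 (by norm_num))) (hnear (-1) (by norm_num))
  have hcoarse := (eLpNorm_logNear_zero_le a hp (fun j A d hj hd hA =>
    eLpNorm_le_of_lintegral_le hp0
      (lintegral_expSum_logFiber_le hk hN a hp hp4 hκ0 hj hd hA)) J hJ1).trans
    (add_le_add hfine le_rfl)
  have heq : expSum k a (Finset.Icc (-(N : ℤ)) N) = _ :=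
    funext fun x => expSum_eq_add_logNear_zero k a N x
  rw [heq]
  have h0 := hm (logNear N 0) 0
  have h1 : AEStronglyMeasurable (fun x => expSum k a (Finset.Icc (-(N : ℤ)) 0) x)
    (volume.restrict (Set.Ioo 0 1)) := (continuous_expSum k a _).aestronglyMeasurable
  have h2 := hmc (logBelow N)
  have h3 := hmc (logAbove N)
  have b1 := eLpNorm_le_of_lintegral_le hp0 (lintegral_expSum_nonpos_le hk hN a hp hp4 hκ1)
  have b2 := eLpNorm_le_of_lintegral_le hp0 (lintegral_expSum_logBelow_le hk hN a hp hp4 hκ1)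
  have b3 := eLpNorm_le_of_lintegral_le hp0 (lintegral_expSum_logAbove_le hk hN a hp hp4 hκ1)
  rw [← hX] at b1 b2 b3 hcoarse
  have key := (eLpNorm_add_le ((h0.add h1).add h2) h3 hp1).trans <| add_le_add
    ((eLpNorm_add_le (h0.add h1) h2 hp1).trans <| add_le_add
      ((eLpNorm_add_le h0 h1 hp1).trans <| add_le_add hcoarse b1) b2) b3
  refine key.trans ?_
  have hcast : X + X + X + (4 * J : ℕ) * X + X + X + X = ((6 + 4 * J : ℕ) : ENNReal) * X := by
    push_cast; ring
  rw [hcast]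
  refine mul_le_mul_left ?_ X
  rw [← ENNReal.ofReal_natCast]
  exact ENNReal.ofReal_le_ofReal (add_four_mul_le hJN)

lemma rpow_one_div_majorant_le {k p L N W : ℝ} (hk : 2 ≤ k) (hp : 2 ≤ p) (hL : 1 ≤ L) (hN : 1 ≤ N)
    (hW : 0 ≤ W) :
    (3000 * L ^ 2 * N ^ ((p - 2) / 2 + (1 - 1 / (k - 1)) * (1 - (p - 2) / 2) / 3)
        * W ^ ((p - 2) / 2 + 1)) ^ (1 / p)
      ≤ 3000 * L ^ 2 * N ^ ((2 * k - 1) / (6 * (k - 1)) - (k + 1) / (3 * p * (k - 1)))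
        * Real.sqrt W := by
  have hk1 : k - 1 ≠ 0 := by linarith
  have hp0 : 0 < p := by linarith
  rw [Real.mul_rpow (by positivity) (by positivity), Real.mul_rpow (by positivity) (by positivity),
    ← Real.rpow_mul (by linarith), ← Real.rpow_mul hW, Real.sqrt_eq_rpow]
  have h1 : ((p - 2) / 2 + (1 - 1 / (k - 1)) * (1 - (p - 2) / 2) / 3) * (1 / p)
      = (2 * k - 1) / (6 * (k - 1)) - (k + 1) / (3 * p * (k - 1)) := by
    field_simp; ring
  have h2 : ((p - 2) / 2 + 1) * (1 / p) = 1 / 2 := by field_simp; ring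
  rw [h1, h2]
  have h3 : (3000 * L ^ 2) ^ (1 / p) ≤ 3000 * L ^ 2 := by
    calc (3000 * L ^ 2) ^ (1 / p) ≤ (3000 * L ^ 2) ^ (1 : ℝ) := by
          refine Real.rpow_le_rpow_of_exponent_le (by nlinarith) ?_
          rw [div_le_one hp0]; linarith
      _ = _ := Real.rpow_one _
  gcongr

lemma eLpNorm_expSum_half_le_rpow {k : ℕ} (hk : 2 ≤ k) {N : ℕ} (hN : 0 < N) (a : ℤ → ℂ)
    {p : ℝ} (hp : 2 ≤ p) (hp4 : p ≤ 4) :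
    eLpNorm (expSum k a (Finset.Icc (-(N : ℤ)) N)) (ENNReal.ofReal p)
        (volume.restrict (Set.Ioo 0 1))
      ≤ ENNReal.ofReal (24000 * (1 + Real.log N) ^ 3
        * (N : ℝ) ^ ((2 * (k : ℝ) - 1) / (6 * ((k : ℝ) - 1))
          - ((k : ℝ) + 1) / (3 * p * ((k : ℝ) - 1)))
        * Real.sqrt (∑ n ∈ Finset.Icc (-(N : ℤ)) N, ‖a n‖ ^ 2)) := by
  have hN1 : (1 : ℝ) ≤ N := by exact_mod_cast hN
  have hL := Real.log_nonneg hN1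
  have hk2 : (2 : ℝ) ≤ k := by exact_mod_cast hk
  refine (eLpNorm_expSum_half_le hk hN a hp hp4).trans ?_
  rw [ENNReal.ofReal_rpow_of_nonneg (by positivity) (by positivity),
    ← ENNReal.ofReal_mul (by positivity)]
  refine ENNReal.ofReal_le_ofReal ?_
  calc _ ≤ 8 * (1 + Real.log N) * _ := mul_le_mul_of_nonneg_left
        (rpow_one_div_majorant_le hk2 hp (by linarith) hN1 (by positivity)) (by positivity)
    _ = _ := by ring

lemma exists_norm_expSum_neg_eq (k : ℕ) (a : ℤ → ℂ) (N : ℕ) : ∃ b : ℤ → ℂ,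
    (∀ x, ‖expSum k a (Finset.Icc (-(N : ℤ)) N) (-x)‖ = ‖expSum k b (Finset.Icc (-(N : ℤ)) N) x‖) ∧
      ∑ n ∈ Finset.Icc (-(N : ℤ)) N, ‖b n‖ ^ 2 = ∑ n ∈ Finset.Icc (-(N : ℤ)) N, ‖a n‖ ^ 2 := by
  have hneg : ∀ {M : Type} [AddCommMonoid M] (f : ℤ → M),
      ∑ n ∈ Finset.Icc (-(N : ℤ)) N, f (-n) = ∑ n ∈ Finset.Icc (-(N : ℤ)) N, f n := by
    intro M _ f
    refine Finset.sum_nbij' (fun n => -n) (fun n => -n) ?_ ?_ ?_ ?_ ?_ <;>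
      simp only [Finset.mem_Icc] <;> intros <;> first | omega | simp
  rcases Nat.even_or_odd k with h | h
  · refine ⟨fun n => a (-n), fun x => ?_, hneg fun n => ‖a n‖ ^ 2⟩
    unfold expSum
    rw [← hneg]
    congr 1
    refine Finset.sum_congr rfl fun n _ => ?_
    rw [h.neg_pow]
    push_cast
    congr 2
    ring
  · refine ⟨fun n => starRingEnd ℂ (a n), fun x => ?_, by simp⟩
    rw [← Complex.norm_conj]
    unfold expSum
    rw [map_sum]
    congr 1
    refine Finset.sum_congr rfl fun n _ => ?_
    rw [map_mul, conj_e, h.neg_pow]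
    congr 2
    ring

lemma eLpNorm_restrict_Ioo_neg_one_one_le {f : ℝ → ℂ} (hf : Continuous f) {p : ENNReal}
    (hp : 1 ≤ p) :
    eLpNorm f p (volume.restrict (Set.Ioo (-1) 1))
      ≤ eLpNorm f p (volume.restrict (Set.Ioo 0 1))
        + eLpNorm (fun x => f (-x)) p (volume.restrict (Set.Ioo 0 1)) := by
  have hmeas : ∀ μ : Measure ℝ, AEStronglyMeasurable f μ := fun μ => hf.aestronglyMeasurable
  have hrefl : eLpNorm (fun x => f (-x)) p (volume.restrict (Set.Ioo 0 1))
      = eLpNorm f p (volume.restrict (Set.Ioo (-1) 0)) := by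
    have h := (Measure.measurePreserving_neg (volume : Measure ℝ)).restrict_preimage
      (measurableSet_Ioo (a := (-1 : ℝ)) (b := 0))
    have h2 : Neg.neg ⁻¹' Set.Ioo (-1 : ℝ) 0 = Set.Ioo 0 1 := by
      ext x; simp
    rw [h2] at h
    exact eLpNorm_comp_measurePreserving (hmeas _) h
  rw [hrefl]
  have hsplit : f = (Set.Ioi 0).indicator f + (Set.Iic 0).indicator f := by
    rw [← Set.compl_Ioi, Set.indicator_self_add_compl]
  have h1 : eLpNorm ((Set.Ioi 0).indicator f) p (volume.restrict (Set.Ioo (-1) 1))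
      = eLpNorm f p (volume.restrict (Set.Ioo 0 1)) := by
    rw [eLpNorm_indicator_eq_eLpNorm_restrict measurableSet_Ioi,
      Measure.restrict_restrict measurableSet_Ioi, Set.inter_comm, Set.Ioo_inter_Ioi]
    simp
  have hset : Set.Iic (0 : ℝ) ∩ Set.Ioo (-1) 1 = Set.Ioc (-1) 0 := by
    ext x; simp only [Set.mem_inter_iff, Set.mem_Iic, Set.mem_Ioo, Set.mem_Ioc]; grind
  have h2 : eLpNorm ((Set.Iic 0).indicator f) p (volume.restrict (Set.Ioo (-1) 1))
      = eLpNorm f p (volume.restrict (Set.Ioo (-1) 0)) := by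
    rw [eLpNorm_indicator_eq_eLpNorm_restrict measurableSet_Iic,
      Measure.restrict_restrict measurableSet_Iic, hset, restrict_Ioo_eq_restrict_Ioc]
  conv_lhs => rw [hsplit]
  rw [← h1, ← h2]
  exact eLpNorm_add_le ((hmeas _).indicator measurableSet_Ioi)
    ((hmeas _).indicator measurableSet_Iic) hp

lemma exists_one_add_log_pow_three_le {ε : ℝ} (hε : 0 < ε) : ∃ C > 0, ∀ N : ℝ, 1 ≤ N →
    (1 + Real.log N) ^ 3 ≤ C * N ^ ε := by
  refine ⟨(1 + 3 / ε) ^ 3, by positivity, fun N hN => ?_⟩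
  have hL := Real.log_nonneg hN
  have h1 := Real.log_le_rpow_div (show 0 ≤ N by linarith) (show 0 < ε / 3 by positivity)
  have h2 : 1 ≤ N ^ (ε / 3) := Real.one_le_rpow hN (by positivity)
  have h3 : 1 + Real.log N ≤ (1 + 3 / ε) * N ^ (ε / 3) := by
    have : N ^ (ε / 3) / (ε / 3) = 3 / ε * N ^ (ε / 3) := by field_simp
    linarith
  calc (1 + Real.log N) ^ 3 ≤ ((1 + 3 / ε) * N ^ (ε / 3)) ^ 3 := by gcongr
    _ = (1 + 3 / ε) ^ 3 * N ^ ε := by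
      rw [mul_pow, ← Real.rpow_natCast (N ^ (ε / 3)), ← Real.rpow_mul (by linarith)]
      congr 2
      push_cast; ring

/-- **Theorem 13, range `2 ≤ p ≤ 4`.** For `k ≥ 2`, `p ∈ [2,4]` and `ε > 0` there is
`C_ε > 0` such that for every `N ≥ 1` and all `(a_n)_{n=-N}^N`,
`‖∑ a_n e(nx − n²xᵏ)‖_{L^p(-1,1)}
  ≤ C_ε N^{(2k−1)/(6(k−1)) − (k+1)/(3p(k−1)) + ε} (∑ |a_n|²)^{1/2}`. -/
theorem stmt15 (k : ℕ) (hk : 2 ≤ k) (p : ℝ) (hp2 : 2 ≤ p) (hp4 : p ≤ 4) :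
    ∀ ε > (0:ℝ), ∃ Cε > (0:ℝ), ∀ N : ℕ, 0 < N → ∀ a : ℤ → ℂ,
      eLpNorm (fun x : ℝ =>
          ∑ n ∈ Finset.Icc (-(N:ℤ)) (N:ℤ), a n * e ((n:ℝ) * x - (n:ℝ)^2 * x^k))
        (ENNReal.ofReal p) (volume.restrict (Set.Ioo (-1) 1))
      ≤ ENNReal.ofReal
          (Cε * (N:ℝ) ^ ((2 * (k:ℝ) - 1) / (6 * ((k:ℝ) - 1))
              - ((k:ℝ) + 1) / (3 * p * ((k:ℝ) - 1)) + ε) *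
            Real.sqrt (∑ n ∈ Finset.Icc (-(N:ℤ)) (N:ℤ), ‖a n‖^2)) := by
  intro ε hε
  obtain ⟨C, hC, hlog⟩ := exists_one_add_log_pow_three_le hε
  refine ⟨48000 * C, by positivity, fun N hN a => ?_⟩
  have hN1 : (1 : ℝ) ≤ N := by exact_mod_cast hN
  have hp1 : 1 ≤ ENNReal.ofReal p := by
    rw [← ENNReal.ofReal_one]; exact ENNReal.ofReal_le_ofReal (by linarith)
  obtain ⟨b, hb, hbW⟩ := exists_norm_expSum_neg_eq k a N
  have h1 := eLpNorm_expSum_half_le_rpow hk hN a hp2 hp4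
  have h2 := eLpNorm_expSum_half_le_rpow hk hN b hp2 hp4
  rw [hbW, ← eLpNorm_congr_norm_ae (Filter.Eventually.of_forall hb)] at h2
  refine (eLpNorm_restrict_Ioo_neg_one_one_le
    (continuous_expSum k a (Finset.Icc (-(N : ℤ)) N)) hp1).trans ((add_le_add h1 h2).trans ?_)
  have hL := Real.log_nonneg hN1
  rw [← ENNReal.ofReal_add (by positivity) (by positivity)]
  refine ENNReal.ofReal_le_ofReal ?_
  rw [Real.rpow_add (by linarith)]
  set R := (N : ℝ) ^ ((2 * (k : ℝ) - 1) / (6 * ((k : ℝ) - 1))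
    - ((k : ℝ) + 1) / (3 * p * ((k : ℝ) - 1)))
  set S := Real.sqrt (∑ n ∈ Finset.Icc (-(N : ℤ)) N, ‖a n‖ ^ 2)
  calc 24000 * (1 + Real.log N) ^ 3 * R * S + 24000 * (1 + Real.log N) ^ 3 * R * S
      = (48000 * R * S) * (1 + Real.log N) ^ 3 := by ring
    _ ≤ (48000 * R * S) * (C * (N : ℝ) ^ ε) :=
        mul_le_mul_of_nonneg_left (hlog N hN1) (by positivity)
    _ = _ := by ring
end

section
/- Let k ≥ 2 be an integer and let p ≥ 4 be real. Then there exists a constant c > 0, depending only on k and p, such that for every positive integer N the constant-coefficient exponential sum satisfies ‖∑_{n=-N}^{N} e(n x − n² x^k)‖_{L^p(-1,1)} ≥ c N^{1 − 1/p}; in particular, taking a_n = 1 for all |n| ≤ N, the left-hand side is at least c N^{1/2 − 1/p} (∑_{n=-N}^{N} |a_n|²)^{1/2}. -/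
open MeasureTheory

theorem half_le_re_e {t : ℝ} (ht : |t| ≤ 1 / 8) : 1 / 2 ≤ (e t).re := by
  have he : e t = Complex.exp (((2 * Real.pi * t : ℝ) : ℂ) * Complex.I) := by
    unfold e
    push_cast
    ring_nf
  rw [he, Complex.exp_ofReal_mul_I_re]
  have h1 := Real.one_sub_sq_div_two_le_cos (x := 2 * Real.pi * t)
  have h2 : t ^ 2 ≤ (1 / 8) ^ 2 := sq_le_sq' (abs_le.mp ht).1 (abs_le.mp ht).2
  have h3 : Real.pi ^ 2 ≤ 3.15 ^ 2 := pow_le_pow_left₀ Real.pi_pos.le Real.pi_lt_d2.le 2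
  have h4 : Real.pi ^ 2 * t ^ 2 ≤ 3.15 ^ 2 * (1 / 8) ^ 2 := by gcongr
  nlinarith

theorem abs_phase_le {k N : ℕ} (hk : 2 ≤ k) (hN : 0 < N) {x : ℝ} (hx : |x| ≤ 1 / (16 * N))
    {n : ℤ} (hn : n ∈ Finset.Icc (-(N : ℤ)) N) :
    |(n : ℝ) * x - (n : ℝ) ^ 2 * x ^ k| ≤ 1 / 8 := by
  have hN' : (1 : ℝ) ≤ N := by exact_mod_cast hN
  have hn' : |(n : ℝ)| ≤ N := by
    rw [Finset.mem_Icc] at hn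
    exact_mod_cast abs_le.mpr hn
  have hx1 : |x| ≤ 1 := hx.trans (by rw [div_le_one (by positivity)]; linarith)
  have hnx : |(n : ℝ)| * |x| ≤ 1 / 16 :=
    calc |(n : ℝ)| * |x| ≤ N * (1 / (16 * N)) := by gcongr
      _ = 1 / 16 := by field_simp
  calc |(n : ℝ) * x - (n : ℝ) ^ 2 * x ^ k|
      ≤ |(n : ℝ) * x| + |(n : ℝ) ^ 2 * x ^ k| := abs_sub _ _
    _ = |(n : ℝ)| * |x| + |(n : ℝ)| ^ 2 * |x| ^ k := by simp only [abs_mul, abs_pow]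
    _ ≤ |(n : ℝ)| * |x| + |(n : ℝ)| ^ 2 * |x| ^ 2 := by
        gcongr |(n : ℝ)| * |x| + |(n : ℝ)| ^ 2 * ?_
        exact pow_le_pow_of_le_one (abs_nonneg x) hx1 hk
    _ = |(n : ℝ)| * |x| + (|(n : ℝ)| * |x|) ^ 2 := by ring
    _ ≤ 1 / 16 + (1 / 16) ^ 2 := by gcongr
    _ ≤ 1 / 8 := by norm_num

theorem le_norm_sum_e {k N : ℕ} (hk : 2 ≤ k) (hN : 0 < N) {x : ℝ} (hx : |x| ≤ 1 / (16 * N)) :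
    (N : ℝ) ≤ ‖∑ n ∈ Finset.Icc (-(N : ℤ)) (N : ℤ), e ((n : ℝ) * x - (n : ℝ) ^ 2 * x ^ k)‖ := by
  refine le_trans ?_ (Complex.re_le_norm _)
  rw [Complex.re_sum]
  have h := Finset.card_nsmul_le_sum (Finset.Icc (-(N : ℤ)) (N : ℤ))
    (fun n => (e ((n : ℝ) * x - (n : ℝ) ^ 2 * x ^ k)).re) (1 / 2)
    (fun n hn => half_le_re_e (abs_phase_le hk hN hx hn))
  have hc : (Finset.Icc (-(N : ℤ)) (N : ℤ)).card = 2 * N + 1 := by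
    rw [Int.card_Icc]
    omega
  rw [hc, nsmul_eq_mul] at h
  push_cast at h
  linarith

theorem le_eLpNorm_sum_e {k N : ℕ} (hk : 2 ≤ k) (hN : 0 < N) {p : ℝ} (hp : 0 < p) :
    ENNReal.ofReal ((1 / 8 : ℝ) ^ (1 / p) * (N : ℝ) ^ (1 - 1 / p))
      ≤ eLpNorm (fun x : ℝ =>
          ∑ n ∈ Finset.Icc (-(N : ℤ)) (N : ℤ), e ((n : ℝ) * x - (n : ℝ) ^ 2 * x ^ k))
        (ENNReal.ofReal p) (volume.restrict (Set.Ioo (-1) 1)) := by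
  have hN' : (1 : ℝ) ≤ N := by exact_mod_cast hN
  have hN0 : (0 : ℝ) < N := by linarith
  set δ : ℝ := 1 / (16 * N) with hδ
  have hδ0 : 0 < δ := by positivity
  have hδ1 : δ ≤ 1 := by
    rw [hδ, div_le_one (by positivity)]
    linarith
  have hsub : Set.Ioo (-δ) δ ⊆ Set.Ioo (-1) 1 := Set.Ioo_subset_Ioo (by linarith) hδ1
  refine le_trans ?_ (eLpNorm_mono_measure _ (Measure.restrict_mono hsub le_rfl))
  have hconst : eLpNorm (fun _ : ℝ => (N : ℝ)) (ENNReal.ofReal p)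
      (volume.restrict (Set.Ioo (-δ) δ))
      = ENNReal.ofReal ((1 / 8 : ℝ) ^ (1 / p) * (N : ℝ) ^ (1 - 1 / p)) := by
    rw [eLpNorm_const' _ (by simpa using hp) ENNReal.ofReal_ne_top, Measure.restrict_apply_univ,
      Real.volume_Ioo, ENNReal.toReal_ofReal hp.le, Real.enorm_of_nonneg hN0.le,
      ENNReal.ofReal_rpow_of_pos (by linarith), ← ENNReal.ofReal_mul hN0.le]
    congr 1
    have h2 : δ - -δ = (1 / 8) * (N : ℝ)⁻¹ := by
      rw [hδ]
      field_simp
      norm_num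
    rw [h2, Real.mul_rpow (by norm_num) (by positivity), Real.inv_rpow hN0.le,
      Real.rpow_sub hN0, Real.rpow_one]
    ring
  rw [← hconst]
  refine eLpNorm_mono_ae ?_
  filter_upwards [ae_restrict_mem measurableSet_Ioo] with x hx
  rw [Real.norm_of_nonneg hN0.le]
  exact le_norm_sum_e hk hN (abs_lt.mpr hx).le

/-- **Sharpness of Theorem 13 for `p ≥ 4`.** For `k ≥ 2` and real `p ≥ 4` there is
`c > 0` such that for every `N ≥ 1` the constant-coefficient sum satisfies
`‖∑_{n=-N}^N e(nx − n²xᵏ)‖_{L^p(-1,1)} ≥ c N^{1 − 1/p}`; in particular, with `a_n = 1`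
the left-hand side is at least `c N^{1/2 − 1/p} (∑ |a_n|²)^{1/2}`. -/
theorem stmt17 (k : ℕ) (hk : 2 ≤ k) (p : ℝ) (hp : 4 ≤ p) :
    ∃ c > (0:ℝ), ∀ N : ℕ, 0 < N →
      ENNReal.ofReal (c * (N:ℝ) ^ ((1:ℝ) - 1/p))
        ≤ eLpNorm (fun x : ℝ =>
            ∑ n ∈ Finset.Icc (-(N:ℤ)) (N:ℤ), e ((n:ℝ) * x - (n:ℝ)^2 * x^k))
          (ENNReal.ofReal p) (volume.restrict (Set.Ioo (-1) 1)) ∧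
      ENNReal.ofReal
          (c * (N:ℝ) ^ ((1:ℝ)/2 - 1/p) *
            Real.sqrt (∑ n ∈ Finset.Icc (-(N:ℤ)) (N:ℤ), ‖(1:ℂ)‖^2))
        ≤ eLpNorm (fun x : ℝ =>
            ∑ n ∈ Finset.Icc (-(N:ℤ)) (N:ℤ), (1:ℂ) * e ((n:ℝ) * x - (n:ℝ)^2 * x^k))
          (ENNReal.ofReal p) (volume.restrict (Set.Ioo (-1) 1)) := by
  have hp0 : 0 < p := by linarith
  refine ⟨(1 / 8 : ℝ) ^ (1 / p) / 2, by positivity, fun N hN => ?_⟩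
  have hN' : (1 : ℝ) ≤ N := by exact_mod_cast hN
  have hN0 : (0 : ℝ) < N := by linarith
  have hmain := le_eLpNorm_sum_e hk hN hp0
  simp only [one_mul]
  refine ⟨(ENNReal.ofReal_le_ofReal ?_).trans hmain, (ENNReal.ofReal_le_ofReal ?_).trans hmain⟩
  · gcongr
    exact half_le_self (by positivity)
  · have hsum : ∑ n ∈ Finset.Icc (-(N : ℤ)) (N : ℤ), ‖(1 : ℂ)‖ ^ 2 = 2 * N + 1 := by
      have hc : (Finset.Icc (-(N : ℤ)) (N : ℤ)).card = 2 * N + 1 := by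
        rw [Int.card_Icc]
        omega
      simp [hc]
    have hsqrt : Real.sqrt (2 * N + 1) ≤ 2 * (N : ℝ) ^ (1 / 2 : ℝ) := by
      rw [← Real.sqrt_eq_rpow]
      refine Real.sqrt_le_iff.mpr ⟨by positivity, ?_⟩
      rw [mul_pow, Real.sq_sqrt hN0.le]
      linarith
    have hpow : (N : ℝ) ^ (1 - 1 / p) = (N : ℝ) ^ (1 / 2 - 1 / p) * (N : ℝ) ^ (1 / 2 : ℝ) := by
      rw [← Real.rpow_add hN0]
      ring_nf
    rw [hsum, hpow]
    calc (1 / 8 : ℝ) ^ (1 / p) / 2 * (N : ℝ) ^ (1 / 2 - 1 / p) * Real.sqrt (2 * N + 1)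
        ≤ (1 / 8 : ℝ) ^ (1 / p) / 2 * (N : ℝ) ^ (1 / 2 - 1 / p) * (2 * (N : ℝ) ^ (1 / 2 : ℝ)) := by
          gcongr
      _ = (1 / 8 : ℝ) ^ (1 / p) * ((N : ℝ) ^ (1 / 2 - 1 / p) * (N : ℝ) ^ (1 / 2 : ℝ)) := by ring
end
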